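/- The mean distance and variance over the corner vertices satisfy lim_{n→∞} n·ξ'(n,1)/2^n = 3/2 + √3/4 and lim_{n→∞} n·(ξ'(n,2) − ξ'(n,1)²)/2^{2n} = 31/24 (i.e. the variance σ² satisfies σ² ∼ (31/3)·2^{2n−3}/n). -/

import Mathlib

open scoped Classical
open Filter Topology

noncomputable section

namespace SierpinskiGasket

/-- √3 -/
def sq3 : ℝ := Real.sqrt 3

/-- the origin, leftmost outmost vertex of every `SG n` -/
def o : ℝ × ℝ := (0, 0)

/-- `a m = (2^m, 0)`, the rightmost vertex of `SG m` (also a translation vector). -/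
def a (m : ℕ) : ℝ × ℝ := ((2:ℝ) ^ m, 0)

/-- `b m = (2^(m-1), 2^(m-1)·√3)`, the topmost vertex of `SG m`. -/
def b (m : ℕ) : ℝ × ℝ := ((2:ℝ) ^ m / 2, (2:ℝ) ^ m / 2 * sq3)

/-- `c m = (3·2^(m-1), 2^(m-1)·√3)`. -/
def c (m : ℕ) : ℝ × ℝ := (3 * (2:ℝ) ^ m / 2, (2:ℝ) ^ m / 2 * sq3)

/-- vertex set of `SG n` -/
def V : ℕ → Set (ℝ × ℝ)
  | 0 => {o, a 0, b 0}
  | n + 1 => V n ∪ ((· + a n) '' V n) ∪ ((· + b n) '' V n)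

/-- edge set of `SG n` -/
def E : ℕ → Set (Sym2 (ℝ × ℝ))
  | 0 => {s(o, a 0), s(o, b 0), s(a 0, b 0)}
  | n + 1 => E n ∪ (Sym2.map (· + a n) '' E n) ∪ (Sym2.map (· + b n) '' E n)

/-- `SG n` as a simple graph on `ℝ × ℝ` -/
def G (n : ℕ) : SimpleGraph (ℝ × ℝ) := SimpleGraph.fromEdgeSet (E n)

/-- a Hamiltonian path of `SG n`: a path visiting every vertex of `SG n` exactly once -/
def IsHamPath (n : ℕ) {u v : ℝ × ℝ} (p : (G n).Walk u v) : Prop :=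
  p.IsPath ∧ ∀ x, x ∈ p.support ↔ x ∈ V n

/-- a Hamiltonian cycle of `SG n` -/
def IsHamCycle (n : ℕ) {u : ℝ × ℝ} (p : (G n).Walk u u) : Prop :=
  p.IsCycle ∧ ∀ x, x ∈ p.support ↔ x ∈ V n

/-- `f n u v`: the number of Hamiltonian paths of `SG n` with end-vertex set `{u, v}`
(for `u ≠ v`, such unordered paths correspond bijectively to walks from `u` to `v`). -/
def f (n : ℕ) (u v : ℝ × ℝ) : ℕ := Nat.card {p : (G n).Walk u v // IsHamPath n p}

/-- `f1 n`: the number of Hamiltonian paths of `SG n` with end-vertex set `{o, a n}` -/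
def f1 (n : ℕ) : ℕ := f n o (a n)

/-- the number of Hamiltonian cycles of `SG n`, counted up to starting vertex and
orientation: every Hamiltonian cycle passes through `o` and has exactly two
representatives as a closed walk based at `o`. -/
def HC (n : ℕ) : ℕ := Nat.card {p : (G n).Walk o o // IsHamCycle n p} / 2

/-- the number of Hamiltonian paths of `SG n` having `o` as one of their end vertices -/
def H0 (n : ℕ) : ℕ := ∑ᶠ x ∈ {x : ℝ × ℝ | x ≠ o}, f n o x

/-- the total number of Hamiltonian paths of `SG n` (a path and its reversal
are the same unordered object, whence the division by `2`). -/
def H (n : ℕ) : ℕ := (∑ᶠ u : ℝ × ℝ, ∑ᶠ v : ℝ × ℝ, f n u v) / 2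

/-- the distribution ratio `F(n,x) = f(n,x)/f1(n)` -/
def F (n : ℕ) (x : ℝ × ℝ) : ℝ := (f n o x : ℝ) / (f1 n : ℝ)

/-- `SG n` with the vertex `b n` (and its incident edges) deleted -/
def Gd (n : ℕ) : SimpleGraph (ℝ × ℝ) := SimpleGraph.fromEdgeSet {e ∈ E n | b n ∉ e}

/-- Hamiltonian path of `SG n - b n` -/
def IsHamPathD (n : ℕ) {u v : ℝ × ℝ} (p : (Gd n).Walk u v) : Prop :=
  p.IsPath ∧ ∀ x, x ∈ p.support ↔ (x ∈ V n ∧ x ≠ b n)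

/-- `g2 n x`: the number of Hamiltonian paths of `SG n - b n` with end-vertex set `{o, x}` -/
def g2 (n : ℕ) (x : ℝ × ℝ) : ℕ := Nat.card {p : (Gd n).Walk o x // IsHamPathD n p}

/-- `g1 n`: the number of Hamiltonian paths of `SG n - b n` with end-vertex set `{o, a n}` -/
def g1 (n : ℕ) : ℕ := g2 n (a n)

/-- the distribution ratio `G₂(n,x) = g₂(n,x)/g₁(n)` -/
def G2 (n : ℕ) (x : ℝ × ℝ) : ℝ := (g2 n x : ℝ) / (g1 n : ℝ)

/-- mid-side vertex `a_{m,1} = (3·2^(m-1), 0)` -/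
def a1 (m : ℕ) : ℝ × ℝ := (3 * (2:ℝ) ^ m / 2, 0)

/-- mid-side vertex `b_{m,1} = (5·2^(m-2), 2^(m-2)·√3)` -/
def b1 (m : ℕ) : ℝ × ℝ := (5 * (2:ℝ) ^ m / 4, (2:ℝ) ^ m / 4 * sq3)

/-- mid-side vertex `c_{m,1} = (7·2^(m-2), 2^(m-2)·√3)` -/
def c1 (m : ℕ) : ℝ × ℝ := (7 * (2:ℝ) ^ m / 4, (2:ℝ) ^ m / 4 * sq3)

/-- mid-side vertex `a_{m,2} = (2^m, 2^(m-1)·√3)` -/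
def a2 (m : ℕ) : ℝ × ℝ := ((2:ℝ) ^ m, (2:ℝ) ^ m / 2 * sq3)

/-- mid-side vertex `b_{m,2} = (3·2^(m-2), 3·2^(m-2)·√3)` -/
def b2 (m : ℕ) : ℝ × ℝ := (3 * (2:ℝ) ^ m / 4, 3 * (2:ℝ) ^ m / 4 * sq3)

/-- mid-side vertex `c_{m,2} = (5·2^(m-2), 3·2^(m-2)·√3)` -/
def c2 (m : ℕ) : ℝ × ℝ := (5 * (2:ℝ) ^ m / 4, 3 * (2:ℝ) ^ m / 4 * sq3)

/-- exceptional vertex `a* = (2^(n-1), (2^(n-1)-1)·√3)` -/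
def astar (n : ℕ) : ℝ × ℝ := ((2:ℝ) ^ n / 2, ((2:ℝ) ^ n / 2 - 1) * sq3)

/-- exceptional vertex `b* = (2^(n-1) - 1/2, (2^n-1)·√3/2)` -/
def bstar (n : ℕ) : ℝ × ℝ := ((2:ℝ) ^ n / 2 - 1/2, ((2:ℝ) ^ n - 1) * sq3 / 2)

/-- exceptional vertex `c* = (2^(n-1) + 1/2, (2^n-1)·√3/2)` -/
def cstar (n : ℕ) : ℝ × ℝ := ((2:ℝ) ^ n / 2 + 1/2, ((2:ℝ) ^ n - 1) * sq3 / 2)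

/-- the Euclidean norm on `ℝ × ℝ` -/
def enorm (x : ℝ × ℝ) : ℝ := Real.sqrt (x.1 ^ 2 + x.2 ^ 2)

/-- the set `C n` of corner vertices of `SG n` -/
def C (n : ℕ) : Finset (ℝ × ℝ) :=
  ((Finset.range (n + 1)).image a) ∪ ((Finset.range (n + 1)).image b) ∪
    ((Finset.range n).image c)

/-- the mean `ℓ` displacement over the corner vertices -/
def xi' (n : ℕ) (ℓ : ℝ) : ℝ :=
  (∑ x ∈ C n, enorm x ^ ℓ * F n x) / (∑ x ∈ C n, F n x)

/-- `p(n,x)`: the probability that a Hamiltonian path with one end at `o`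
has its other end at `x` -/
def p (n : ℕ) (x : ℝ × ℝ) : ℝ := (f n o x : ℝ) / (H0 n : ℝ)

/-- the mean `ℓ` displacement of Hamiltonian paths on `SG n` with one end at `o` -/
def xi (n : ℕ) (ℓ : ℝ) : ℝ :=
  ∑ᶠ x ∈ {x : ℝ × ℝ | x ∈ V n ∧ x ≠ o}, enorm x ^ ℓ * p n x

/-- the partition function of Hamiltonian paths on `SG n` -/
def Z (n : ℕ) (β : ℝ) : ℝ := (H n : ℝ) * Real.exp (-(β * ((3 ^ (n + 1) + 1) / 2)))

section
variable {α : Type*}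

/-- `l` is a path from `u` to `v` along the edges in `E` that visits every vertex in `W` exactly
once and no others. -/
def IsHam (E : Set (Sym2 α)) (W : Set α) (u v : α) (l : List α) : Prop :=
  l.Nodup ∧ l.IsChain (fun x y => s(x, y) ∈ E) ∧ l.head? = some u ∧ l.getLast? = some v ∧
    ∀ x, x ∈ l ↔ x ∈ W

/-- The set of Hamiltonian paths from `u` to `v` in the graph `(W, E)`. -/
def ham (E : Set (Sym2 α)) (W : Set α) (u v : α) : Set (List α) := {l | IsHam E W u v l}

/-- The number of Hamiltonian paths from `u` to `v` in the graph `(W, E)`. -/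
def N (E : Set (Sym2 α)) (W : Set α) (u v : α) : ℕ := (ham E W u v).ncard

lemma ham_finite (E : Set (Sym2 α)) (W : Set α) (u v : α) : (ham E W u v).Finite := by
  rcases (ham E W u v).eq_empty_or_nonempty with h | ⟨l, hl⟩
  · simp [h]
  · refine (List.finite_toSet l.permutations).subset fun m hm => ?_
    simp only [Set.mem_ofPred_eq, List.mem_permutations]
    exact (List.perm_ext_iff_of_nodup hm.1 hl.1).2 fun x => by rw [hm.2.2.2.2, hl.2.2.2.2]

lemma IsHam.reverse {E : Set (Sym2 α)} {W : Set α} {u v : α} {l : List α}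
    (h : IsHam E W u v l) : IsHam E W v u l.reverse := by
  obtain ⟨h1, h2, h3, h4, h5⟩ := h
  refine ⟨by simpa, ?_, by simpa, by simpa, by simpa⟩
  rw [List.isChain_reverse]
  simpa [Sym2.eq_swap] using h2

lemma N_comm (E : Set (Sym2 α)) (W : Set α) (u v : α) : N E W u v = N E W v u := by
  refine Set.ncard_congr (fun l _ => l.reverse) (fun l hl => hl.reverse) (by simp) ?_
  exact fun l hl => ⟨l.reverse, hl.reverse, by simp⟩

/-- Inside `WA ∪ WB`, the edges of `EA` stay in `WA` and those of `EB` stay in `WB`. -/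
structure Glued (EA EB : Set (Sym2 α)) (WA WB : Set α) : Prop where
  left : ∀ x y, s(x, y) ∈ EA → x ∈ WA ∪ WB → y ∈ WA ∪ WB → x ∈ WA ∧ y ∈ WA
  right : ∀ x y, s(x, y) ∈ EB → x ∈ WA ∪ WB → y ∈ WA ∪ WB → x ∈ WB ∧ y ∈ WB

section
variable {EA EB : Set (Sym2 α)} {WA WB : Set α} {u v s t c : α}

lemma Glued.segment (h : Glued EA EB WA WB) (l : List α) : ∀ x y : α,
    (x :: (l ++ [y])).IsChain (fun x y => s(x, y) ∈ EA ∪ EB) →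
    (∀ z ∈ x :: (l ++ [y]), z ∈ WA ∪ WB) → (∀ z ∈ l, ¬ (z ∈ WA ∧ z ∈ WB)) →
    ((x :: (l ++ [y])).IsChain (fun x y => s(x, y) ∈ EA) ∧ ∀ z ∈ x :: (l ++ [y]), z ∈ WA) ∨
    ((x :: (l ++ [y])).IsChain (fun x y => s(x, y) ∈ EB) ∧ ∀ z ∈ x :: (l ++ [y]), z ∈ WB) := by
  induction l with
  | nil =>
    intro x y h1 h2 h3
    simp only [List.nil_append, List.isChain_cons_cons, List.isChain_singleton, and_true,
      List.mem_cons, List.not_mem_nil, or_false, forall_eq_or_imp, forall_eq] at *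
    rcases h1 with h1 | h1
    · exact .inl ⟨h1, h.left _ _ h1 h2.1 h2.2⟩
    · exact .inr ⟨h1, h.right _ _ h1 h2.1 h2.2⟩
  | cons z l ih =>
    intro x y h1 h2 h3
    simp only [List.cons_append, List.isChain_cons_cons, List.mem_cons,
      forall_eq_or_imp] at ih h1 h2 h3 ⊢
    have := ih z y h1.2 h2.2 h3.2
    have hl := h.left x z
    have hr := h.right x z
    grind

lemma IsHam.exists_split {E : Set (Sym2 α)} {W : Set α} {l : List α} (h : IsHam E W u v l)
    (hc : c ∈ W) (hu : c ≠ u) (hv : c ≠ v) : ∃ l₁ l₂, l = u :: (l₁ ++ c :: (l₂ ++ [v])) := by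
  obtain ⟨-, -, h3, h4, h5⟩ := h
  obtain ⟨l₁, l₂, rfl⟩ := List.append_of_mem ((h5 c).2 hc)
  rcases l₁ with - | ⟨x, l₁⟩
  · simp_all
  · obtain rfl : x = u := by simpa using h3
    rcases List.eq_nil_or_concat l₂ with rfl | ⟨l₂, y, rfl⟩
    · rw [List.getLast?_append] at h4
      exact absurd (by simpa using h4) hv
    · rw [List.getLast?_append] at h4
      obtain rfl : y = v := by simpa [List.getLast?_cons] using h4
      exact ⟨l₁, l₂, by simp⟩

lemma IsHam.exists_split_pair {E : Set (Sym2 α)} {W : Set α} {l : List α} (h : IsHam E W u v l)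
    (hs : s ∈ W) (ht : t ∈ W) (hst : s ≠ t) (hsu : s ≠ u) (hsv : s ≠ v) (htu : t ≠ u)
    (htv : t ≠ v) :
    (∃ l₁ l₂ l₃, l = u :: (l₁ ++ s :: (l₂ ++ t :: (l₃ ++ [v])))) ∨
    (∃ l₁ l₂ l₃, l = u :: (l₁ ++ t :: (l₂ ++ s :: (l₃ ++ [v])))) := by
  obtain ⟨l₁, l₂, rfl⟩ := h.exists_split hs hsu hsv
  have : t ∈ l₁ ∨ t ∈ l₂ := by simpa [htu, htv, hst.symm] using (h.2.2.2.2 t).2 ht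
  rcases this with h | h
  · obtain ⟨m₁, m₂, rfl⟩ := List.append_of_mem h
    exact .inr ⟨m₁, m₂, l₂, by simp⟩
  · obtain ⟨m₁, m₂, rfl⟩ := List.append_of_mem h
    exact .inl ⟨l₁, m₁, m₂, by simp⟩

/-- `l` is a Hamiltonian path of `X` from `u` to `j` followed by one of `Y` from `j` to `v`. -/
def Splits (EA EB : Set (Sym2 α)) (X Y : Set α) (u j v : α) (l : List α) : Prop :=
  ∃ l₁ l₂, l = l₁ ++ j :: l₂ ∧ IsHam EA X u j (l₁ ++ [j]) ∧ IsHam EB Y j v (j :: l₂)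

lemma IsHam.length_eq {E E' : Set (Sym2 α)} {W : Set α} {u' v' : α} {l m : List α}
    (hl : IsHam E W u v l) (hm : IsHam E' W u' v' m) : l.length = m.length :=
  ((List.perm_ext_iff_of_nodup hl.1 hm.1).2 fun x => by
    rw [hm.2.2.2.2, hl.2.2.2.2]).length_eq

lemma ncard_splits (EA EB : Set (Sym2 α)) (X Y : Set α) (u j v : α) :
    {l | Splits EA EB X Y u j v l}.ncard = N EA X u j * N EB Y j v := by
  have key : ∀ l, IsHam EB Y j v l → j :: l.tail = l := by
    rintro (- | ⟨x, l⟩) ⟨-, -, h, -⟩ <;> simp_all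
  have : {l | Splits EA EB X Y u j v l} =
      (fun p : List α × List α => p.1 ++ p.2.tail) '' (ham EA X u j ×ˢ ham EB Y j v) := by
    ext l
    constructor
    · rintro ⟨l₁, l₂, rfl, h1, h2⟩
      exact ⟨(l₁ ++ [j], j :: l₂), ⟨h1, h2⟩, by simp⟩
    · rintro ⟨⟨l₁, l₂⟩, ⟨h1, h2⟩, rfl⟩
      rcases List.eq_nil_or_concat l₁ with rfl | ⟨l₁, y, rfl⟩
      · simpa using h1.2.2.1
      · obtain rfl : y = j := by simpa using h1.2.2.2.1
        exact ⟨l₁, l₂.tail, by simp, by simpa [ham] using h1, by rw [key l₂ h2]; exact h2⟩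
  rw [this, Set.InjOn.ncard_image, Set.ncard_prod, N, N]
  rintro ⟨l₁, l₂⟩ ⟨h1, h2⟩ ⟨m₁, m₂⟩ ⟨h3, h4⟩ h
  obtain ⟨h5, h6⟩ := List.append_inj h (h1.length_eq h3)
  simp only at h1 h2 h3 h4 h5 h6
  rw [Prod.mk.injEq, h5, ← key l₂ h2, ← key m₂ h4, h6]
  simp

lemma finite_splits (EA EB : Set (Sym2 α)) (X Y : Set α) (u j v : α) :
    {l | Splits EA EB X Y u j v l}.Finite := by
  refine (((ham_finite EA X u j).prod (ham_finite EB Y j v)).image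
    (fun p : List α × List α => p.1 ++ p.2.tail)).subset ?_
  rintro l ⟨l₁, l₂, rfl, h1, h2⟩
  exact ⟨(l₁ ++ [j], j :: l₂), ⟨h1, h2⟩, by simp⟩

lemma Splits.isHam {X Y W : Set α} {j : α} {l : List α} (h : Splits EA EB X Y u j v l)
    (hXY : ∀ z ∈ X, z ∈ Y → z = j) (hW : X ∪ Y = W) : IsHam (EA ∪ EB) W u v l := by
  obtain ⟨l₁, l₂, rfl, ⟨h1, h2, h3, h4, h5⟩, ⟨g1, g2, g3, g4, g5⟩⟩ := h
  have k2 := h2.imp (S := fun x y => s(x, y) ∈ EA ∪ EB) (fun _ _ h => .inl h)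
  have k3 := g2.imp (S := fun x y => s(x, y) ∈ EA ∪ EB) (fun _ _ h => .inr h)
  refine ⟨?_, List.isChain_split.2 ⟨k2, k3⟩, ?_, ?_, ?_⟩
  · subst hW
    simp only [List.nodup_append, List.nodup_cons, List.mem_append, List.mem_cons] at *
    grind
  · cases l₁ <;> simp_all
  · rw [List.getLast?_append]; simp [g4]
  · subst hW
    intro x
    simp only [List.mem_append, List.mem_cons, Set.mem_union] at *
    grind

lemma isHam_cons_concat {E : Set (Sym2 α)} {W : Set α} {l : List α} :
    IsHam E W u v (u :: (l ++ [v])) ↔ (u :: (l ++ [v])).Nodup ∧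
      (u :: (l ++ [v])).IsChain (fun x y => s(x, y) ∈ E) ∧
      ∀ x, x = u ∨ x ∈ l ∨ x = v ↔ x ∈ W := by
  have : (u :: (l ++ [v])).getLast? = some v := by simp [List.getLast?_cons]
  simp [IsHam, this]

lemma isHam_iff_splits (h : Glued EA EB WA WB) (hc : ∀ z, z ∈ WA ∧ z ∈ WB ↔ z = c)
    (hu : u ∈ WA) (huc : u ≠ c) (hv : v ∈ WB) (hvc : v ≠ c) (l : List α) :
    IsHam (EA ∪ EB) (WA ∪ WB) u v l ↔ Splits EA EB WA WB u c v l := by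
  refine ⟨fun H => ?_, fun H => H.isHam (fun z h1 h2 => (hc z).1 ⟨h1, h2⟩) rfl⟩
  have hcW := (hc c).2 rfl
  obtain ⟨l₁, l₂, rfl⟩ := H.exists_split (c := c) (.inl hcW.1) huc.symm hvc.symm
  obtain ⟨h1, h2, h3, h4, h5⟩ := H
  rw [← List.cons_append, List.isChain_split] at h2
  have k1 := h.segment l₁ u c h2.1
  have k2 := h.segment l₂ c v h2.2
  clear h2 h3 h4
  simp only [List.mem_append, List.mem_cons, List.not_mem_nil, or_false, List.nodup_cons,
    List.nodup_append, Set.mem_union] at h1 h5 k1 k2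
  replace k1 := (k1 (by grind) (by grind)).resolve_right (by grind)
  replace k2 := (k2 (by grind) (by grind)).resolve_left (by grind)
  refine ⟨u :: l₁, l₂ ++ [v], by simp, isHam_cons_concat.2 ⟨?_, k1.1, ?_⟩,
    isHam_cons_concat.2 ⟨?_, k2.1, ?_⟩⟩
  · clear k1 k2
    simp only [List.mem_append, List.mem_cons, List.not_mem_nil, or_false, List.nodup_cons,
      List.nodup_append]
    grind
  · replace k1 := k1.2
    replace k2 := k2.2
    grind
  · clear k1 k2
    simp only [List.mem_append, List.mem_cons, List.not_mem_nil, or_false, List.nodup_cons,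
      List.nodup_append]
    grind
  · replace k1 := k1.2
    replace k2 := k2.2
    grind

lemma N_eq_mul (h : Glued EA EB WA WB) (hc : ∀ z, z ∈ WA ∧ z ∈ WB ↔ z = c)
    (hu : u ∈ WA) (huc : u ≠ c) (hv : v ∈ WB) (hvc : v ≠ c) :
    N (EA ∪ EB) (WA ∪ WB) u v = N EA WA u c * N EB WB c v := by
  rw [← ncard_splits, N, ham]
  congr 1
  ext l
  exact isHam_iff_splits h hc hu huc hv hvc l

lemma IsHam.exists_eq {E : Set (Sym2 α)} {W : Set α} {l : List α} (h : IsHam E W u v l)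
    (huv : u ≠ v) : ∃ l₁, l = u :: (l₁ ++ [v]) := by
  obtain ⟨-, -, h3, h4, h5⟩ := h
  rcases l with - | ⟨x, l⟩
  · simp at h3
  · obtain rfl : x = u := by simpa using h3
    rcases List.eq_nil_or_concat l with rfl | ⟨l, y, rfl⟩
    · exact absurd (by simpa using h4) huv
    · obtain rfl : y = v := by simpa [List.getLast?_cons] using h4
      exact ⟨l, by simp⟩

lemma N_eq_zero (h : Glued EA EB WA WB) (hc : ∀ z, z ∈ WA ∧ z ∈ WB ↔ z = c)
    (hu : u ∈ WA) (huc : u ≠ c) (hv : v ∈ WA) (huv : u ≠ v) {w : α} (hw : w ∈ WB) (hwc : w ≠ c) :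
    N (EA ∪ EB) (WA ∪ WB) u v = 0 := by
  rw [N, Set.ncard_eq_zero (ham_finite _ _ _ _), Set.eq_empty_iff_forall_notMem]
  intro l (H : IsHam _ _ _ _ _)
  have hcW := (hc c).2 rfl
  by_cases hvc : v = c
  · subst hvc
    obtain ⟨l, rfl⟩ := H.exists_eq huv
    obtain ⟨h1, h2, h3, h4, h5⟩ := H
    have k1 := h.segment l u v h2
    clear h2 h3 h4
    simp only [List.mem_append, List.mem_cons, List.not_mem_nil, or_false, List.nodup_cons,
      List.nodup_append, Set.mem_union] at h1 h5 k1
    replace k1 := (k1 (by grind) (by grind)).resolve_right (by grind)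
    replace k1 := k1.2
    grind
  · obtain ⟨l₁, l₂, rfl⟩ := H.exists_split (c := c) (.inl hcW.1) huc.symm (Ne.symm hvc)
    obtain ⟨h1, h2, h3, h4, h5⟩ := H
    rw [← List.cons_append, List.isChain_split] at h2
    have k1 := h.segment l₁ u c h2.1
    have k2 := h.segment l₂ c v h2.2
    clear h2 h3 h4
    simp only [List.mem_append, List.mem_cons, List.not_mem_nil, or_false, List.nodup_cons,
      List.nodup_append, Set.mem_union] at h1 h5 k1 k2
    replace k1 := (k1 (by grind) (by grind)).resolve_right (by grind)
    replace k2 := (k2 (by grind) (by grind)).resolve_right (by grind)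
    replace k1 := k1.2
    replace k2 := k2.2
    grind

lemma N_junction (h : Glued EA EB WA WB) (hJ : ∀ z, z ∈ WA ∧ z ∈ WB ↔ z = s ∨ z = t)
    (hst : s ≠ t) (hu : u ∈ WA) (hus : u ≠ s) (hut : u ≠ t)
    {w : α} (hw : w ∈ WB) (hws : w ≠ s) (hwt : w ≠ t) :
    N (EA ∪ EB) (WA ∪ WB) u s = N EA (WA \ {s}) u t * N EB WB t s := by
  rw [← ncard_splits, N, ham]
  congr 1
  ext l
  have hsW := (hJ s).2 (.inl rfl)
  have htW := (hJ t).2 (.inr rfl)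
  refine ⟨fun H : IsHam _ _ _ _ _ => ?_, fun H : Splits _ _ _ _ _ _ _ _ => H.isHam ?_ ?_⟩
  · obtain ⟨l₁, l₂, rfl⟩ := H.exists_split (c := t) (.inl htW.1) hut.symm hst.symm
    obtain ⟨h1, h2, h3, h4, h5⟩ := H
    rw [← List.cons_append, List.isChain_split] at h2
    have k1 := h.segment l₁ u t h2.1
    have k2 := h.segment l₂ t s h2.2
    clear h2 h3 h4
    simp only [List.mem_append, List.mem_cons, List.not_mem_nil, or_false, List.nodup_cons,
      List.nodup_append, Set.mem_union] at h1 h5 k1 k2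
    replace k1 := (k1 (by grind) (by grind)).resolve_right (by grind)
    replace k2 := (k2 (by grind) (by grind)).resolve_left (by
      replace k1 := k1.2
      clear k2
      grind)
    refine ⟨u :: l₁, l₂ ++ [s], by simp, isHam_cons_concat.2 ⟨?_, k1.1, ?_⟩,
      isHam_cons_concat.2 ⟨?_, k2.1, ?_⟩⟩
    · clear k1 k2
      simp only [List.mem_append, List.mem_cons, List.not_mem_nil, or_false, List.nodup_cons,
        List.nodup_append]
      grind
    · replace k1 := k1.2
      replace k2 := k2.2
      simp only [Set.mem_sdiff, Set.mem_singleton_iff]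
      grind
    · clear k1 k2
      simp only [List.mem_append, List.mem_cons, List.not_mem_nil, or_false, List.nodup_cons,
        List.nodup_append]
      grind
    · replace k1 := k1.2
      replace k2 := k2.2
      grind
  · grind
  · ext z
    simp only [Set.mem_union, Set.mem_sdiff, Set.mem_singleton_iff]
    grind

lemma Glued.splits_of_split_pair (h : Glued EA EB WA WB)
    (hJ : ∀ z, z ∈ WA ∧ z ∈ WB ↔ z = s ∨ z = t)
    (hu : u ∈ WA) (hus : u ≠ s) (hut : u ≠ t) (hv : v ∈ WB) (hvs : v ≠ s)
    (hvt : v ≠ t) {l₁ l₂ l₃ : List α}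
    (H : IsHam (EA ∪ EB) (WA ∪ WB) u v (u :: (l₁ ++ s :: (l₂ ++ t :: (l₃ ++ [v]))))) :
    Splits EA EB WA (WB \ {s}) u t v (u :: (l₁ ++ s :: (l₂ ++ t :: (l₃ ++ [v])))) ∨
    Splits EA EB (WA \ {t}) WB u s v (u :: (l₁ ++ s :: (l₂ ++ t :: (l₃ ++ [v])))) := by
  obtain ⟨h1, h2, h3, h4, h5⟩ := H
  rw [← List.cons_append, List.isChain_split] at h2
  obtain ⟨h2, h2'⟩ := h2
  rw [← List.cons_append, List.isChain_split] at h2'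
  obtain ⟨h2', h2''⟩ := h2'
  have k1 := h.segment l₁ u s h2
  have k2 := h.segment l₂ s t h2'
  have k3 := h.segment l₃ t v h2''
  clear h2 h2' h2'' h3 h4
  simp only [List.mem_append, List.mem_cons, List.not_mem_nil, or_false, List.nodup_cons,
    List.nodup_append, Set.mem_union] at h1 h5 k1 k2 k3
  replace k1 := (k1 (by clear k2 k3; grind) (by clear k2 k3; grind)).resolve_right
    (by clear k2 k3; grind)
  replace k3 := (k3 (by clear k1 k2; grind) (by clear k1 k2; grind)).resolve_left
    (by clear k1 k2; grind)
  replace k2 := k2 (by clear k1 k3; grind) (by clear k1 k3; grind)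
  rcases k2 with k2 | k2
  · refine .inl ⟨u :: (l₁ ++ s :: l₂), l₃ ++ [v], by simp, isHam_cons_concat.2 ⟨?_, ?_, ?_⟩,
      isHam_cons_concat.2 ⟨?_, k3.1, ?_⟩⟩
    · clear k1 k2 k3
      simp only [List.mem_append, List.mem_cons, List.not_mem_nil, or_false, List.nodup_cons,
        List.nodup_append]
      grind
    · rw [List.append_assoc, List.cons_append, ← List.cons_append, List.isChain_split]
      exact ⟨k1.1, k2.1⟩
    · replace k1 := k1.2
      replace k2 := k2.2
      replace k3 := k3.2
      simp only [List.mem_append, List.mem_cons]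
      grind
    · clear k1 k2 k3
      simp only [List.mem_append, List.mem_cons, List.not_mem_nil, or_false, List.nodup_cons,
        List.nodup_append]
      grind
    · replace k1 := k1.2
      replace k2 := k2.2
      replace k3 := k3.2
      simp only [Set.mem_sdiff, Set.mem_singleton_iff]
      grind
  · refine .inr ⟨u :: l₁, l₂ ++ t :: (l₃ ++ [v]), by simp, isHam_cons_concat.2 ⟨?_, k1.1, ?_⟩, ?_⟩
    · clear k1 k2 k3
      simp only [List.mem_append, List.mem_cons, List.not_mem_nil, or_false, List.nodup_cons,
        List.nodup_append]
      grind
    · replace k1 := k1.2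
      replace k2 := k2.2
      replace k3 := k3.2
      simp only [Set.mem_sdiff, Set.mem_singleton_iff]
      grind
    · rw [← List.cons_append (a := t), ← List.append_assoc]
      refine isHam_cons_concat.2 ⟨?_, ?_, ?_⟩
      · clear k1 k2 k3
        simp only [List.mem_append, List.mem_cons, List.not_mem_nil, or_false, List.nodup_cons,
          List.nodup_append]
        grind
      · rw [List.append_assoc, List.cons_append, ← List.cons_append (a := s), List.isChain_split]
        exact ⟨k2.1, k3.1⟩
      · replace k1 := k1.2
        replace k2 := k2.2
        replace k3 := k3.2
        simp only [List.mem_append, List.mem_cons]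
        grind

lemma not_chain_of_mem {l₁ l₂ m₁ m₂ : List α} (hE : ∀ x y, s(x, y) ∈ EA → s(x, y) ∉ EB)
    (hl : (l₁ ++ s :: l₂).Nodup) (h : l₁ ++ s :: l₂ = m₁ ++ t :: m₂)
    (hlB : (s :: l₂).IsChain (fun x y => s(x, y) ∈ EB))
    (hmA : (m₁ ++ [t]).IsChain (fun x y => s(x, y) ∈ EA)) : s ∉ m₁ := by
  intro hs
  obtain ⟨n₁, n₂, rfl⟩ := List.append_of_mem hs
  have hl' := hl
  rw [h] at hl'
  rw [List.append_assoc, List.cons_append] at h hl' hmA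
  obtain ⟨rfl, -, rfl⟩ := (List.append_cons_inj_of_notMem (by grind) (by grind)).1 h
  replace hmA := (List.isChain_split.1 hmA).2
  cases n₂ with
  | nil => simp at hmA hlB; exact hE _ _ hmA hlB.1
  | cons y n => simp at hmA hlB; exact hE _ _ hmA.1 hlB.1

lemma N_cross (h : Glued EA EB WA WB) (hE : ∀ x y, s(x, y) ∈ EA → s(x, y) ∉ EB)
    (hJ : ∀ z, z ∈ WA ∧ z ∈ WB ↔ z = s ∨ z = t) (hst : s ≠ t)
    (hu : u ∈ WA) (hus : u ≠ s) (hut : u ≠ t) (hv : v ∈ WB) (hvs : v ≠ s) (hvt : v ≠ t) :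
    N (EA ∪ EB) (WA ∪ WB) u v =
      (N EA WA u s * N EB (WB \ {t}) s v + N EA (WA \ {t}) u s * N EB WB s v) +
      (N EA WA u t * N EB (WB \ {s}) t v + N EA (WA \ {s}) u t * N EB WB t v) := by
  have hsW := (hJ s).2 (.inl rfl)
  have htW := (hJ t).2 (.inr rfl)
  have hJ' : ∀ z, z ∈ WA ∧ z ∈ WB ↔ z = t ∨ z = s := fun z => by rw [hJ, or_comm]
  have hU : ham (EA ∪ EB) (WA ∪ WB) u v =
      ({l | Splits EA EB WA (WB \ {t}) u s v l} ∪ {l | Splits EA EB (WA \ {t}) WB u s v l}) ∪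
      ({l | Splits EA EB WA (WB \ {s}) u t v l} ∪ {l | Splits EA EB (WA \ {s}) WB u t v l}) := by
    ext l
    simp only [Set.mem_union, Set.mem_ofPred_eq]
    constructor
    · intro (H : IsHam _ _ _ _ _)
      rcases H.exists_split_pair (s := s) (t := t) (.inl hsW.1) (.inl htW.1) hst hus.symm hvs.symm
        hut.symm hvt.symm with ⟨l₁, l₂, l₃, rfl⟩ | ⟨l₁, l₂, l₃, rfl⟩
      · have := h.splits_of_split_pair hJ hu hus hut hv hvs hvt H
        tauto
      · have := h.splits_of_split_pair hJ' hu hut hus hv hvt hvs H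
        tauto
    · rintro ((H | H) | (H | H)) <;> refine H.isHam ?_ ?_
      any_goals ext z
      all_goals simp only [Set.mem_union, Set.mem_sdiff, Set.mem_singleton_iff]
      all_goals grind
  have same : ∀ j k, j ≠ k → k ∈ WA → Disjoint {l | Splits EA EB WA (WB \ {k}) u j v l}
      {l | Splits EA EB (WA \ {k}) WB u j v l} := by
    intro j k hjk hk
    rw [Set.disjoint_left]
    rintro l ⟨l₁, l₂, rfl, h1, h2⟩ ⟨m₁, m₂, e, h3, h4⟩
    have h1n := h1.1
    have h2n := h2.1
    obtain ⟨rfl, -, rfl⟩ := (List.append_cons_inj_of_notMem (by grind) (by grind)).1 e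
    exact ((h3.2.2.2.2 k).1 ((h1.2.2.2.2 k).2 hk)).2 rfl
  rw [N, ham, ← ham, hU, Set.ncard_union_eq ?_ ((finite_splits ..).union (finite_splits ..))
    ((finite_splits ..).union (finite_splits ..)),
    Set.ncard_union_eq (same s t hst htW.1) (finite_splits ..) (finite_splits ..),
    Set.ncard_union_eq (same t s hst.symm hsW.1) (finite_splits ..) (finite_splits ..)]
  · simp only [ncard_splits]
  · rw [Set.disjoint_left]
    intro l hl hm
    have hn : l.Nodup := by
      have : l ∈ ham (EA ∪ EB) (WA ∪ WB) u v := hU ▸ .inl hl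
      exact this.1
    obtain ⟨X, Y, l₁, l₂, rfl, h1, h2⟩ : ∃ X Y, Splits EA EB X Y u s v l := by
      rcases hl with hl | hl <;> exact ⟨_, _, hl⟩
    obtain ⟨X', Y', m₁, m₂, e, h3, h4⟩ : ∃ X Y, Splits EA EB X Y u t v (l₁ ++ s :: l₂) := by
      rcases hm with hl | hl <;> exact ⟨_, _, hl⟩
    have k1 := not_chain_of_mem hE hn e h2.2.1 h3.2.1
    have k2 := not_chain_of_mem hE (e ▸ hn) e.symm h4.2.1 h1.2.1
    have : s ∈ m₁ ∨ s = t ∨ s ∈ m₂ := by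
      have : s ∈ m₁ ++ t :: m₂ := by simp [← e]
      simpa using this
    have hs : s ∈ m₂ := by tauto
    obtain ⟨n₁, n₂, rfl⟩ := List.append_of_mem hs
    have e' : l₁ ++ s :: l₂ = (m₁ ++ t :: n₁) ++ s :: n₂ := by simp [e]
    have hn' := hn
    rw [e'] at hn'
    obtain ⟨rfl, -⟩ := (List.append_cons_inj_of_notMem (by grind) (by grind)).1 e'
    simp at k2

/-- Pairs of disjoint paths covering `X`, the first from `u` to `s`, the second from `t` to `v`. -/
def detour (E : Set (Sym2 α)) (X : Set α) (u s t v : α) : Set (List α × List α) :=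
  {p | (p.1 ++ s :: t :: p.2).Nodup ∧ (p.1 ++ [s]).IsChain (fun x y => s(x, y) ∈ E) ∧
    (t :: p.2).IsChain (fun x y => s(x, y) ∈ E) ∧ (p.1 ++ [s]).head? = some u ∧
    (t :: p.2).getLast? = some v ∧ ∀ x, x ∈ p.1 ++ s :: t :: p.2 ↔ x ∈ X}

lemma exists_of_mem_ham {E : Set (Sym2 α)} {W : Set α} (hst : s ≠ t) {m : List α}
    (hm : m ∈ ham E W s t) : ∃ m', m = s :: (m' ++ [t]) :=
  IsHam.exists_eq hm hst

/-- Paths going from `u` to `s`, then through all of `WB` to `t`, then to `v`. -/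
def through (EA EB : Set (Sym2 α)) (X WB : Set α) (u s t v : α) : Set (List α) :=
  (fun p : List α × List α × List α => p.2.1 ++ p.1 ++ p.2.2) ''
    (ham EB WB s t ×ˢ detour EA X u s t v)

lemma ncard_through {X : Set α} (hst : s ≠ t) : (through EA EB X WB u s t v).ncard =
    N EB WB s t * (detour EA X u s t v).ncard := by
  rw [through, Set.InjOn.ncard_image, Set.ncard_prod, N]
  rintro ⟨m, l₁, l₂⟩ ⟨hm, hl⟩ ⟨m', k₁, k₂⟩ ⟨hm', hk⟩ e
  obtain ⟨n, rfl⟩ := exists_of_mem_ham hst hm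
  obtain ⟨n', rfl⟩ := exists_of_mem_ham hst hm'
  have h1 := hm.1
  have h2 := hl.1
  simp only [List.cons_append, List.append_assoc, List.nil_append] at e h1 h2
  simp only [List.nodup_append, List.nodup_cons, List.mem_cons, List.mem_append] at h1 h2
  obtain ⟨rfl, -, e⟩ := (List.append_cons_inj_of_notMem (by grind) (by grind)).1 e
  obtain ⟨rfl, -, rfl⟩ := (List.append_cons_inj_of_notMem (by grind) (by grind)).1 e
  rfl

lemma isHam_of_mem_through (hJ : ∀ z, z ∈ WA ∧ z ∈ WB ↔ z = s ∨ z = t) (hst : s ≠ t)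
    {l : List α} (h : l ∈ through EA EB WA WB u s t v) : IsHam (EA ∪ EB) (WA ∪ WB) u v l := by
  obtain ⟨⟨m, l₁, l₂⟩, ⟨hm, hl⟩, rfl⟩ := h
  obtain ⟨m, rfl⟩ := exists_of_mem_ham hst hm
  obtain ⟨m1, m2, -, -, m5⟩ := hm
  obtain ⟨h1, h2, h3, h4, h5, h6⟩ := hl
  dsimp only at *
  simp only [List.cons_append, List.append_assoc, List.nil_append]
  refine ⟨?_, ?_, ?_, ?_, ?_⟩
  · clear m2 h2 h3 h4 h5
    simp only [List.nodup_append, List.nodup_cons, List.mem_cons, List.mem_append,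
      List.not_mem_nil, or_false] at *
    grind
  · refine List.isChain_split.2 ⟨h2.imp fun _ _ => .inl, ?_⟩
    rw [← List.cons_append]
    exact List.isChain_split.2 ⟨m2.imp fun _ _ => .inr, h3.imp fun _ _ => .inl⟩
  · cases l₁ <;> simp_all
  · simpa [List.getLast?_append, List.getLast?_cons] using h5
  · clear m1 m2 h1 h2 h3 h4 h5
    simp only [List.mem_cons, List.mem_append, List.not_mem_nil, or_false, Set.mem_union] at *
    grind

lemma Glued.mem_through (h : Glued EA EB WA WB)
    (hJ : ∀ z, z ∈ WA ∧ z ∈ WB ↔ z = s ∨ z = t)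
    (hu : u ∈ WA) (hus : u ≠ s) (hut : u ≠ t) (hv : v ∈ WA) (hvs : v ≠ s)
    (hvt : v ≠ t) {w : α} (hw : w ∈ WB) (hws : w ≠ s) (hwt : w ≠ t) {l₁ l₂ l₃ : List α}
    (H : IsHam (EA ∪ EB) (WA ∪ WB) u v (u :: (l₁ ++ s :: (l₂ ++ t :: (l₃ ++ [v]))))) :
    u :: (l₁ ++ s :: (l₂ ++ t :: (l₃ ++ [v]))) ∈ through EA EB WA WB u s t v := by
  obtain ⟨h1, h2, h3, h4, h5⟩ := H
  rw [← List.cons_append, List.isChain_split] at h2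
  obtain ⟨h2, h2'⟩ := h2
  rw [← List.cons_append, List.isChain_split] at h2'
  obtain ⟨h2', h2''⟩ := h2'
  have k1 := h.segment l₁ u s h2
  have k2 := h.segment l₂ s t h2'
  have k3 := h.segment l₃ t v h2''
  clear h2 h2' h2'' h3 h4
  simp only [List.mem_append, List.mem_cons, List.not_mem_nil, or_false, List.nodup_cons,
    List.nodup_append, Set.mem_union] at h1 h5 k1 k2 k3
  replace k1 := (k1 (by clear k2 k3; grind) (by clear k2 k3; grind)).resolve_right
    (by clear k2 k3; grind)
  replace k3 := (k3 (by clear k1 k2; grind) (by clear k1 k2; grind)).resolve_right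
    (by clear k1 k2; grind)
  replace k2 := (k2 (by clear k1 k3; grind) (by clear k1 k3; grind)).resolve_left (by
    have k1' := k1.2
    have k3' := k3.2
    intro k2
    replace k2 := k2.2
    clear k1 k3
    grind)
  refine ⟨(s :: (l₂ ++ [t]), u :: l₁, l₃ ++ [v]), ⟨isHam_cons_concat.2 ⟨?_, k2.1, ?_⟩,
    ?_, k1.1, k3.1, by simp, by simp [List.getLast?_cons], ?_⟩, by simp⟩
  · clear k1 k2 k3
    simp only [List.mem_append, List.mem_cons, List.not_mem_nil, or_false, List.nodup_cons,
      List.nodup_append]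
    grind
  · replace k1 := k1.2
    replace k2 := k2.2
    replace k3 := k3.2
    grind
  · clear k1 k2 k3
    simp only [List.mem_append, List.mem_cons, List.not_mem_nil, or_false, List.nodup_cons,
      List.nodup_append]
    grind
  · replace k1 := k1.2
    replace k2 := k2.2
    replace k3 := k3.2
    simp only [List.mem_append, List.mem_cons]
    grind

lemma N_eq_mul_detour (h : Glued EA EB WA WB) (hJ : ∀ z, z ∈ WA ∧ z ∈ WB ↔ z = s ∨ z = t)
    (hst : s ≠ t) (hu : u ∈ WA) (hus : u ≠ s) (hut : u ≠ t) (hv : v ∈ WA) (hvs : v ≠ s)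
    (hvt : v ≠ t) {w : α} (hw : w ∈ WB) (hws : w ≠ s) (hwt : w ≠ t) :
    N (EA ∪ EB) (WA ∪ WB) u v =
      N EB WB s t * ((detour EA WA u s t v).ncard + (detour EA WA u t s v).ncard) := by
  have hJ' : ∀ z, z ∈ WA ∧ z ∈ WB ↔ z = t ∨ z = s := fun z => by rw [hJ, or_comm]
  have hU : ham (EA ∪ EB) (WA ∪ WB) u v =
      through EA EB WA WB u s t v ∪ through EA EB WA WB u t s v := by
    ext l
    constructor
    · intro (H : IsHam _ _ _ _ _)
      rcases H.exists_split_pair (s := s) (t := t) (.inr ((hJ s).2 (.inl rfl)).2)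
        (.inr ((hJ t).2 (.inr rfl)).2) hst hus.symm hvs.symm hut.symm hvt.symm
        with ⟨l₁, l₂, l₃, rfl⟩ | ⟨l₁, l₂, l₃, rfl⟩
      · exact .inl (h.mem_through hJ hu hus hut hv hvs hvt hw hws hwt H)
      · exact .inr (h.mem_through hJ' hu hut hus hv hvt hvs hw hwt hws H)
    · rintro (H | H)
      · exact isHam_of_mem_through hJ hst H
      · exact isHam_of_mem_through hJ' hst.symm H
  have hf := ham_finite (EA ∪ EB) (WA ∪ WB) u v
  rw [hU] at hf
  rw [mul_add, N, hU, Set.ncard_union_eq ?_ (hf.subset Set.subset_union_left)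
    (hf.subset Set.subset_union_right), ncard_through hst, ncard_through hst.symm, N_comm EB WB t s]
  rw [Set.disjoint_left]
  rintro _ ⟨⟨m, l₁, l₂⟩, ⟨hm, hl⟩, rfl⟩ ⟨⟨m', k₁, k₂⟩, ⟨hm', hk⟩, e⟩
  obtain ⟨n, rfl⟩ := exists_of_mem_ham hst hm
  obtain ⟨n', rfl⟩ := exists_of_mem_ham hst.symm hm'
  have h1 := hm.1
  have h2 := hl.1
  have h1' := hm'.1
  have h2' := hk.1
  simp only [List.cons_append, List.append_assoc, List.nil_append] at e h1 h2 h1' h2'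
  simp only [List.nodup_append, List.nodup_cons, List.mem_cons, List.mem_append] at h1 h2 h1' h2'
  have e' : (k₁ ++ t :: n') ++ s :: k₂ = l₁ ++ s :: (n ++ t :: l₂) := by simp [e]
  obtain ⟨rfl, -, -⟩ := (List.append_cons_inj_of_notMem (by grind) (by grind)).1 e'
  grind

end

lemma N_congr {E E' : Set (Sym2 α)} {W : Set α}
    (h : ∀ x ∈ W, ∀ y ∈ W, s(x, y) ∈ E ↔ s(x, y) ∈ E') (u v : α) : N E W u v = N E' W u v := by
  rw [N, N]
  congr 1
  ext l
  refine and_congr_right fun _ => ⟨?_, ?_⟩ <;> rintro ⟨h2, h3, h4, h5⟩ <;>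
    refine ⟨List.IsChain.imp_of_mem_imp ?_ h2, h3, h4, h5⟩
  · exact fun x y hx hy => (h x ((h5 x).1 hx) y ((h5 y).1 hy)).1
  · exact fun x y hx hy => (h x ((h5 x).1 hx) y ((h5 y).1 hy)).2

lemma N_equiv {β : Type*} (e : α ≃ β) (E : Set (Sym2 α)) (W : Set α) (u v : α) :
    N (Sym2.map e '' E) (e '' W) (e u) (e v) = N E W u v := by
  symm
  have key : ∀ x y, s(e x, e y) ∈ Sym2.map e '' E ↔ s(x, y) ∈ E := fun x y => by
    rw [← Sym2.map_mk, (Sym2.map.injective e.injective).mem_set_image]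
  have : ∀ l, l.map e ∈ ham (Sym2.map e '' E) (e '' W) (e u) (e v) ↔ l ∈ ham E W u v := fun l => by
    simp only [ham, IsHam, Set.mem_ofPred_eq, List.nodup_map_iff e.injective, List.isChain_map,
      List.head?_map, List.getLast?_map, e.surjective.forall, e.injective.mem_set_image,
      List.mem_map_of_injective e.injective, ← Option.map_some,
      (Option.map_injective e.injective).eq_iff]
    rw [show (fun x y => s(e x, e y) ∈ Sym2.map e '' E) = fun x y => s(x, y) ∈ E by
      funext x y; exact propext (key x y)]
  refine Set.ncard_congr (fun l _ => l.map e) (fun l hl => (this l).2 hl)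
    (fun l m _ _ h => List.map_injective_iff.2 e.injective h) fun l hl => ⟨l.map e.symm, ?_, ?_⟩
  · rw [← this]
    simpa using hl
  · simp

def Within (E : Set (Sym2 α)) (V : Set α) : Prop := ∀ x y, s(x, y) ∈ E → x ∈ V ∧ y ∈ V ∧ x ≠ y

section
variable {EA EB : Set (Sym2 α)} {VA VB X Y : Set α} {u v s t c w : α}

lemma Within.union (hA : Within EA VA) (hB : Within EB VB) : Within (EA ∪ EB) (VA ∪ VB) := by
  rintro x y (h | h)
  · have := hA x y h; simp; tauto
  · have := hB x y h; simp; tauto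

lemma Within.glued (hA : Within EA VA) (hB : Within EB VB) (h1 : ∀ z ∈ Y, z ∈ VA → z ∈ X)
    (h2 : ∀ z ∈ X, z ∈ VB → z ∈ Y) : Glued EA EB X Y := by
  constructor
  · rintro x y h hx hy
    have := hA x y h
    exact ⟨hx.elim id fun h => h1 _ h this.1, hy.elim id fun h => h1 _ h this.2.1⟩
  · rintro x y h hx hy
    have := hB x y h
    exact ⟨hx.elim (fun h => h2 _ h this.1) id, hy.elim (fun h => h2 _ h this.2.1) id⟩

lemma Within.N_mul (hA : Within EA VA) (hB : Within EB VB) (hc : ∀ z, z ∈ VA ∧ z ∈ VB ↔ z = c)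
    (hX : X ⊆ VA) (hY : Y ⊆ VB) (cX : c ∈ X) (cY : c ∈ Y) (hu : u ∈ X) (huc : u ≠ c)
    (hv : v ∈ Y) (hvc : v ≠ c) : N (EA ∪ EB) (X ∪ Y) u v = N EA X u c * N EB Y c v :=
  N_eq_mul (hA.glued hB (by grind) (by grind)) (by grind) hu huc hv hvc

lemma Within.N_zero (hA : Within EA VA) (hB : Within EB VB) (hc : ∀ z, z ∈ VA ∧ z ∈ VB ↔ z = c)
    (hX : X ⊆ VA) (hY : Y ⊆ VB) (cX : c ∈ X) (cY : c ∈ Y) (hu : u ∈ X) (huc : u ≠ c)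
    (hv : v ∈ X) (huv : u ≠ v) (hw : w ∈ Y) (hwc : w ≠ c) : N (EA ∪ EB) (X ∪ Y) u v = 0 :=
  N_eq_zero (hA.glued hB (by grind) (by grind)) (by grind) hu huc hv huv hw hwc

end

/-- A graph with three corners in which the number of Hamiltonian paths between two corners
is `f`, and `g` after deletion of the third corner. -/
structure Piece (f g : ℕ) (p q r : α) (V : Set α) (E : Set (Sym2 α)) : Prop where
  pq : p ≠ q
  pr : p ≠ r
  qr : q ≠ r
  mp : p ∈ V
  mq : q ∈ V
  mr : r ∈ V
  within : Within E V
  fpq : N E V p q = f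
  fpr : N E V p r = f
  fqr : N E V q r = f
  gpq : N E (V \ {r}) p q = g
  gpr : N E (V \ {q}) p r = g
  gqr : N E (V \ {p}) q r = g

section
variable {f g : ℕ} {p q r a b c : α} {V : Set α} {E : Set (Sym2 α)}

lemma Piece.swap_left (h : Piece f g p q r V E) : Piece f g q p r V E where
  pq := h.pq.symm
  pr := h.qr
  qr := h.pr
  mp := h.mq
  mq := h.mp
  mr := h.mr
  within := h.within
  fpq := by rw [N_comm, h.fpq]
  fpr := h.fqr
  fqr := h.fpr
  gpq := by rw [N_comm, h.gpq]
  gpr := h.gqr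
  gqr := h.gpr

lemma Piece.swap_right (h : Piece f g p q r V E) : Piece f g p r q V E where
  pq := h.pr
  pr := h.pq
  qr := h.qr.symm
  mp := h.mp
  mq := h.mr
  mr := h.mq
  within := h.within
  fpq := h.fpr
  fpr := h.fpq
  fqr := by rw [N_comm, h.fqr]
  gpq := h.gpr
  gpr := h.gpq
  gqr := by rw [N_comm, h.gqr]

lemma Piece.equiv {β : Type*} (h : Piece f g p q r V E) (e : α ≃ β) :
    Piece f g (e p) (e q) (e r) (e '' V) (Sym2.map e '' E) where
  pq := e.injective.ne h.pq
  pr := e.injective.ne h.pr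
  qr := e.injective.ne h.qr
  mp := Set.mem_image_of_mem e h.mp
  mq := Set.mem_image_of_mem e h.mq
  mr := Set.mem_image_of_mem e h.mr
  within := by
    rintro x y ⟨d, hd, hxy⟩
    induction d with | _ x' y'
    have := h.within x' y' hd
    rw [Sym2.map_mk, Sym2.eq_iff] at hxy
    rcases hxy with ⟨rfl, rfl⟩ | ⟨rfl, rfl⟩ <;> simp [this, this.2.2.symm]
  fpq := by rw [N_equiv, h.fpq]
  fpr := by rw [N_equiv, h.fpr]
  fqr := by rw [N_equiv, h.fqr]
  gpq := by rw [← Set.image_singleton, ← Set.image_sdiff e.injective, N_equiv, h.gpq]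
  gpr := by rw [← Set.image_singleton, ← Set.image_sdiff e.injective, N_equiv, h.gpr]
  gqr := by rw [← Set.image_singleton, ← Set.image_sdiff e.injective, N_equiv, h.gqr]

lemma N_triangle (hpq : p ≠ q) (hpr : p ≠ r) (hqr : q ≠ r)
    (h1 : s(p, r) ∈ E) (h2 : s(r, q) ∈ E) : N E {p, q, r} p q = 1 := by
  rw [N, Set.ncard_eq_one]
  refine ⟨[p, r, q], Set.eq_singleton_iff_unique_mem.2 ⟨?_, fun l hl => ?_⟩⟩
  · simp [ham, IsHam, h1, h2, hpq, hpr, hqr.symm]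
    grind
  · obtain ⟨l, rfl⟩ := IsHam.exists_eq hl hpq
    obtain ⟨h1, h2, h3, h4, h5⟩ := hl
    clear h2 h3 h4
    rcases l with - | ⟨x, - | ⟨y, l⟩⟩
    all_goals
      have h6 := h5 r
      simp at h1 h5 h6 ⊢
    · grind
    · grind
    · have := h5 x
      have := h5 y
      grind

lemma N_edge (hpq : p ≠ q) (h1 : s(p, q) ∈ E) : N E {p, q} p q = 1 := by
  rw [N, Set.ncard_eq_one]
  refine ⟨[p, q], Set.eq_singleton_iff_unique_mem.2 ⟨?_, fun l hl => ?_⟩⟩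
  · simp [ham, IsHam, h1, hpq]
  · obtain ⟨l, rfl⟩ := IsHam.exists_eq hl hpq
    obtain ⟨h1, h2, h3, h4, h5⟩ := hl
    clear h2 h3 h4
    rcases l with - | ⟨x, l⟩
    · rfl
    · have := h5 x
      simp at h1 this
      grind

lemma Piece.triangle (hpq : p ≠ q) (hpr : p ≠ r) (hqr : q ≠ r) :
    Piece 1 1 p q r {p, q, r} {s(p, q), s(p, r), s(q, r)} where
  pq := hpq
  pr := hpr
  qr := hqr
  mp := by simp
  mq := by simp
  mr := by simp
  within := by
    intro x y h
    simp only [Set.mem_insert_iff, Set.mem_singleton_iff, Sym2.eq_iff] at h ⊢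
    rcases h with ⟨rfl, rfl⟩ | ⟨rfl, rfl⟩ | h <;> grind
  fpq := by exact N_triangle hpq hpr hqr (by simp) (by simp)
  fpr := by
    rw [Set.pair_comm q r]
    exact N_triangle hpr hpq hqr.symm (by simp) (by simp)
  fqr := by
    rw [Set.insert_comm p q, Set.pair_comm p r]
    exact N_triangle hqr hpq.symm hpr.symm (by simp) (by simp)
  gpq := by
    rw [show ({p, q, r} : Set α) \ {r} = {p, q} by ext; simp; grind]
    exact N_edge hpq (by simp)
  gpr := by
    rw [show ({p, q, r} : Set α) \ {q} = {p, r} by ext; simp; grind]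
    exact N_edge hpr (by simp)
  gqr := by
    rw [show ({p, q, r} : Set α) \ {p} = {q, r} by ext; simp; grind]
    exact N_edge hqr (by simp)

end

/-- Three pieces glued pairwise at corners, as the three parts of a Sierpinski gasket. -/
structure Glue3 (f g : ℕ) (p q r a b c : α) (V₀ V₁ V₂ : Set α) (E₀ E₁ E₂ : Set (Sym2 α)) :
    Prop where
  h0 : Piece f g p a b V₀ E₀
  h1 : Piece f g a q c V₁ E₁
  h2 : Piece f g b c r V₂ E₂
  h01 : ∀ z, z ∈ V₀ ∧ z ∈ V₁ ↔ z = a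
  h02 : ∀ z, z ∈ V₀ ∧ z ∈ V₂ ↔ z = b
  h12 : ∀ z, z ∈ V₁ ∧ z ∈ V₂ ↔ z = c

namespace Glue3
variable {f g : ℕ} {p q r a b c w : α} {V₀ V₁ V₂ : Set α} {E₀ E₁ E₂ : Set (Sym2 α)}

lemma swap_left (h : Glue3 f g p q r a b c V₀ V₁ V₂ E₀ E₁ E₂) :
    Glue3 f g q p r a c b V₁ V₀ V₂ E₁ E₀ E₂ where
  h0 := h.h1.swap_left
  h1 := h.h0.swap_left
  h2 := h.h2.swap_left
  h01 z := by rw [and_comm, h.h01]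
  h02 := h.h12
  h12 := h.h02

lemma swap_right (h : Glue3 f g p q r a b c V₀ V₁ V₂ E₀ E₁ E₂) :
    Glue3 f g p r q b a c V₀ V₂ V₁ E₀ E₂ E₁ where
  h0 := h.h0.swap_right
  h1 := h.h2.swap_right
  h2 := h.h1.swap_right
  h01 := h.h02
  h02 := h.h01
  h12 z := by rw [and_comm, h.h12]

variable (h : Glue3 f g p q r a b c V₀ V₁ V₂ E₀ E₁ E₂)
include h

lemma distinct : (p ∉ V₁ ∧ p ∉ V₂ ∧ q ∉ V₀ ∧ q ∉ V₂ ∧ r ∉ V₀ ∧ r ∉ V₁) ∧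
    (a ∉ V₂ ∧ b ∉ V₁ ∧ c ∉ V₀) ∧
    (a ∈ V₀ ∧ a ∈ V₁ ∧ b ∈ V₀ ∧ b ∈ V₂ ∧ c ∈ V₁ ∧ c ∈ V₂) ∧ (p ∈ V₀ ∧ q ∈ V₁ ∧ r ∈ V₂) := by
  obtain ⟨⟨a1, a2, a3, a4, a5, a6, -⟩, ⟨b1, b2, b3, b4, b5, b6, -⟩, ⟨c1, c2, c3, c4, c5, c6, -⟩,
    h01, h02, h12⟩ := h
  grind

lemma within : Within (E₀ ∪ (E₁ ∪ E₂)) (V₀ ∪ (V₁ ∪ V₂)) :=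
  h.h0.within.union (h.h1.within.union h.h2.within)

lemma edges_disjoint (x y : α) (hx : s(x, y) ∈ E₀) : s(x, y) ∉ E₁ ∪ E₂ := by
  have h0 := h.h0.within x y hx
  have h1 := h.h1.within x y
  have h2 := h.h2.within x y
  have := h.h01 x
  have := h.h01 y
  have := h.h02 x
  have := h.h02 y
  rintro (hy | hy) <;> grind

lemma N_corner_aux {Y : Set α} (hY : Y ⊆ V₂) (hb : b ∈ Y) (hc : c ∈ Y) :
    N (E₀ ∪ (E₁ ∪ E₂)) (V₀ ∪ (V₁ ∪ Y)) p q =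
      f * N (E₁ ∪ E₂) (V₁ ∪ Y \ {b}) a q + 2 * f * g * N E₂ Y b c := by
  obtain ⟨d1, d2, d3, d4⟩ := h.distinct
  have hab := h.h0.qr
  have hac := h.h1.pr
  have hbc := h.h2.pq
  have hqc := h.h1.qr
  have w0 := h.h0.within
  have w1 := h.h1.within
  have w2 := h.h2.within
  have w12 := w1.union w2
  have h01 := h.h01
  have h02 := h.h02
  have h12 := h.h12
  have h21 : ∀ z, z ∈ V₂ ∧ z ∈ V₁ ↔ z = c := h.swap_right.h12
  have e1 : (V₁ ∪ Y) \ {b} = V₁ ∪ Y \ {b} := by ext; simp; grind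
  have e2 : (V₁ ∪ Y) \ {a} = V₁ \ {a} ∪ Y := by ext; simp; grind
  rw [N_cross (s := a) (t := b) (w0.glued w12 (by grind) (by grind))
    h.edges_disjoint (by grind) (by grind)
    (by grind) (by grind) (by grind) (by grind) (by grind) (by grind), e1, e2,
    w1.N_zero (X := V₁) (Y := Y) w2 h12 subset_rfl hY (by grind) (by grind) (by grind) (by grind)
      (by grind) (by grind) hb hbc, Set.union_comm E₁ E₂, Set.union_comm _ Y, Set.union_comm _ Y,
    w2.N_mul (X := Y) (Y := V₁) w1 h21 hY subset_rfl (by grind) (by grind) (by grind) (by grind)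
      (by grind) (by grind),
    w2.N_mul (X := Y) (Y := V₁ \ {a}) w1 h21 hY Set.sdiff_subset (by grind) (by grind) (by grind)
      (by grind) (by grind) (by grind),
    N_comm _ _ c q, N_comm _ _ c q, h.h1.fqr, h.h1.gqr, h.h0.fpq, h.h0.fpr, h.h0.gpr]
  ring

lemma N_corner : N (E₀ ∪ (E₁ ∪ E₂)) (V₀ ∪ (V₁ ∪ V₂)) p q = 2 * f ^ 2 * g := by
  obtain ⟨d1, d2, d3, d4⟩ := h.distinct
  rw [h.N_corner_aux subset_rfl (by grind) (by grind), h.h1.within.N_zero h.h2.within h.h12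
    subset_rfl Set.sdiff_subset (by grind) ⟨by grind, h.h2.pq.symm⟩ (by grind) h.h1.pr (by grind)
    h.h1.pq (w := r) ⟨by grind, h.h2.pr.symm⟩ h.h2.qr.symm, h.h2.fpq]
  ring

omit h in
lemma union_sdiff {x : α} (h₀ : x ∉ V₀) (h₁ : x ∉ V₁) :
    (V₀ ∪ (V₁ ∪ V₂)) \ {x} = V₀ ∪ (V₁ ∪ V₂ \ {x}) := by
  ext; simp; grind

lemma N_corner_delete (hw : ∃ w ∈ V₂, w ≠ b ∧ w ≠ c ∧ w ≠ r) :
    N (E₀ ∪ (E₁ ∪ E₂)) ((V₀ ∪ (V₁ ∪ V₂)) \ {r}) p q = 2 * f * g ^ 2 := by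
  obtain ⟨w, w0, w1, w2, w3⟩ := hw
  obtain ⟨d1, d2, d3, d4⟩ := h.distinct
  rw [union_sdiff (by grind) (by grind),
    h.N_corner_aux Set.sdiff_subset ⟨by grind, h.h2.pr⟩ ⟨by grind, h.h2.qr⟩,
    h.h1.within.N_zero h.h2.within h.h12
    subset_rfl (Set.sdiff_subset.trans Set.sdiff_subset) (by grind)
    ⟨⟨by grind, h.h2.qr⟩, h.h2.pq.symm⟩ (by grind) h.h1.pr (by grind)
    h.h1.pq (w := w) ⟨⟨w0, w3⟩, w1⟩ w2, h.h2.gpq]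
  ring

lemma N_corner_delete_of_eq (hV : V₂ = {b, c, r}) :
    N (E₀ ∪ (E₁ ∪ E₂)) ((V₀ ∪ (V₁ ∪ V₂)) \ {r}) p q = 2 * f * g ^ 2 + f ^ 2 := by
  obtain ⟨d1, d2, d3, d4⟩ := h.distinct
  have e : V₁ ∪ (V₂ \ {r}) \ {b} = V₁ := by
    ext z
    simp only [hV, Set.mem_union, Set.mem_sdiff, Set.mem_insert_iff, Set.mem_singleton_iff]
    grind
  rw [union_sdiff (by grind) (by grind),
    h.N_corner_aux Set.sdiff_subset ⟨by grind, h.h2.pr⟩ ⟨by grind, h.h2.qr⟩, h.h2.gpq, e,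
    N_congr (E := E₁ ∪ E₂) (E' := E₁), h.h1.fpq]
  · ring
  · intro x hx y hy
    refine ⟨fun H => H.elim id fun H => ?_, .inl⟩
    have := h.h2.within x y H
    have := h.h12 x
    have := h.h12 y
    grind

lemma piece_of_delete {g' : ℕ}
    (hr : N (E₀ ∪ (E₁ ∪ E₂)) ((V₀ ∪ (V₁ ∪ V₂)) \ {r}) p q = g')
    (hq : N (E₀ ∪ (E₂ ∪ E₁)) ((V₀ ∪ (V₂ ∪ V₁)) \ {q}) p r = g')
    (hp : N (E₁ ∪ (E₂ ∪ E₀)) ((V₁ ∪ (V₂ ∪ V₀)) \ {p}) q r = g') :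
    Piece (2 * f ^ 2 * g) g' p q r (V₀ ∪ (V₁ ∪ V₂)) (E₀ ∪ (E₁ ∪ E₂)) := by
  have h' := h.swap_right.N_corner
  have h'' := h.swap_left.swap_right.N_corner
  rw [Set.union_comm V₂ V₁, Set.union_comm E₂ E₁] at hq h'
  rw [← Set.union_assoc V₁, Set.union_comm _ V₀, ← Set.union_assoc E₁, Set.union_comm _ E₀]
    at hp h''
  obtain ⟨d1, d2, d3, d4⟩ := h.distinct
  refine ⟨?_, ?_, ?_, ?_, ?_, ?_, h.within, h.N_corner, h', h'', hr, hq, hp⟩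
  all_goals grind

lemma piece (w0 : ∃ w ∈ V₀, w ≠ p ∧ w ≠ a ∧ w ≠ b) (w1 : ∃ w ∈ V₁, w ≠ a ∧ w ≠ q ∧ w ≠ c)
    (w2 : ∃ w ∈ V₂, w ≠ b ∧ w ≠ c ∧ w ≠ r) :
    Piece (2 * f ^ 2 * g) (2 * f * g ^ 2) p q r (V₀ ∪ (V₁ ∪ V₂)) (E₀ ∪ (E₁ ∪ E₂)) :=
  h.piece_of_delete (h.N_corner_delete w2) (h.swap_right.N_corner_delete (by grind))
    (h.swap_left.swap_right.N_corner_delete (by grind))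

lemma piece_of_eq (w0 : V₀ = {p, a, b}) (w1 : V₁ = {a, q, c}) (w2 : V₂ = {b, c, r}) :
    Piece (2 * f ^ 2 * g) (2 * f * g ^ 2 + f ^ 2) p q r (V₀ ∪ (V₁ ∪ V₂)) (E₀ ∪ (E₁ ∪ E₂)) := by
  refine h.piece_of_delete (h.N_corner_delete_of_eq w2) (h.swap_right.N_corner_delete_of_eq ?_)
    (h.swap_left.swap_right.N_corner_delete_of_eq ?_)
  · rw [w1, Set.pair_comm]
  · rw [w0, Set.insert_comm, Set.pair_comm p b]

lemma N_left : N (E₀ ∪ (E₁ ∪ E₂)) (V₀ ∪ (V₁ ∪ V₂)) p a = f ^ 2 * g := by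
  obtain ⟨d1, d2, d3, d4⟩ := h.distinct
  have w12 := h.h1.within.union h.h2.within
  have h21 : ∀ z, z ∈ V₂ ∧ z ∈ V₁ ↔ z = c := h.swap_right.h12
  have h01 := h.h01
  have h02 := h.h02
  rw [N_junction (s := a) (t := b) (w := q) (h.h0.within.glued w12 (by grind) (by grind)) (by grind)
    (by grind) (by grind) (by grind) (by grind) (by grind) (by grind) (by grind), h.h0.gpr,
    Set.union_comm E₁, Set.union_comm V₁, h.h2.within.N_mul h.h1.within h21 subset_rfl subset_rfl
    (by grind) (by grind) (by grind) h.h2.pq (by grind) h.h1.pr, h.h2.fpq, N_comm, h.h1.fpr]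
  ring

lemma N_middle : N (E₀ ∪ (E₁ ∪ E₂)) (V₀ ∪ (V₁ ∪ V₂)) p c = 0 := by
  obtain ⟨d1, d2, d3, d4⟩ := h.distinct
  have w0 := h.h0.within
  have w1 := h.h1.within
  have w2 := h.h2.within
  have w12 := w1.union w2
  have h01 := h.h01
  have h02 := h.h02
  have h21 : ∀ z, z ∈ V₂ ∧ z ∈ V₁ ↔ z = c := h.swap_right.h12
  have hac := h.h1.pr
  have hbc := h.h2.pq
  have hqc := h.h1.qr
  have hrc := h.h2.qr
  have hqa := h.h1.pq
  have hrb := h.h2.pr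
  have e1 : (V₁ ∪ V₂) \ {b} = V₁ ∪ V₂ \ {b} := by ext; simp; grind
  have e2 : (V₁ ∪ V₂) \ {a} = V₂ ∪ V₁ \ {a} := by ext; simp; grind
  rw [N_cross (s := a) (t := b) (w0.glued w12 (by grind) (by grind))
    h.edges_disjoint (by grind) (by grind)
    (by grind) (by grind) (by grind) (by grind) (by grind) (by grind), e1, e2,
    w1.N_zero (X := V₁) (Y := V₂ \ {b}) w2 h.h12 subset_rfl Set.sdiff_subset (by grind) (by grind)
      (by grind) (by grind) (by grind) (by grind) (w := r) (by grind) hrc.symm,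
    w1.N_zero (X := V₁) (Y := V₂) w2 h.h12 subset_rfl subset_rfl (by grind) (by grind) (by grind)
      (by grind) (by grind) (by grind) (w := r) (by grind) hrc.symm,
    Set.union_comm E₁ E₂, Set.union_comm V₁ V₂,
    w2.N_zero (X := V₂) (Y := V₁ \ {a}) w1 h21 subset_rfl Set.sdiff_subset (by grind) (by grind)
      (by grind) (by grind) (by grind) (by grind) (w := q) (by grind) hqc,
    w2.N_zero (X := V₂) (Y := V₁) w1 h21 subset_rfl subset_rfl (by grind) (by grind) (by grind)
      (by grind) (by grind) (by grind) (w := q) (by grind) hqc]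
  simp

end Glue3

/-- Three glued pieces, linked to an outer graph through the corners `q` and `r`. -/
structure Link (f g κ : ℕ) (p q r a b c : α) (V₀ V₁ V₂ W : Set α)
    (E₀ E₁ E₂ D : Set (Sym2 α)) : Prop extends Glue3 f g p q r a b c V₀ V₁ V₂ E₀ E₁ E₂ where
  within_out : Within D W
  inter_out : ∀ z, z ∈ V₀ ∪ (V₁ ∪ V₂) ∧ z ∈ W ↔ z = q ∨ z = r
  N_out : N D W q r = κ
  exists_out : ∃ w ∈ W, w ≠ q ∧ w ≠ r

namespace Link
variable {f g κ : ℕ} {p q r a b c w x : α} {V₀ V₁ V₂ W : Set α} {E₀ E₁ E₂ D : Set (Sym2 α)}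

lemma swap_right (h : Link f g κ p q r a b c V₀ V₁ V₂ W E₀ E₁ E₂ D) :
    Link f g κ p r q b a c V₀ V₂ V₁ W E₀ E₂ E₁ D where
  __ := h.toGlue3.swap_right
  within_out := h.within_out
  inter_out z := by rw [Set.union_comm V₂, h.inter_out, or_comm]
  N_out := by rw [N_comm, h.N_out]
  exists_out := by simpa [and_comm] using h.exists_out

variable (h : Link f g κ p q r a b c V₀ V₁ V₂ W E₀ E₁ E₂ D)
include h

lemma mem_out : (q ∈ W ∧ r ∈ W) ∧ (p ∉ W ∧ a ∉ W ∧ b ∉ W ∧ c ∉ W) ∧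
    (∀ z, z ∈ V₂ ∧ z ∈ W ↔ z = r) ∧ (∀ z, z ∈ V₁ ∧ z ∈ W ↔ z = q) ∧ (∀ z, z ∈ V₀ → z ∉ W) := by
  obtain ⟨d1, d2, d3, d4⟩ := h.distinct
  have hI := h.inter_out
  have hap := h.h0.pq
  have hbp := h.h0.pr
  have haq := h.h1.pq
  have hbr := h.h2.pr
  have hcq := h.h1.qr
  have hcr := h.h2.qr
  clear h
  refine ⟨?_, ?_, ?_, ?_, ?_⟩
  · grind
  · have := hI p
    have := hI a
    have := hI b
    have := hI c
    grind
  all_goals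
    intro z
    have := hI z
    grind

lemma glued_aux {X Y Z : Set α} (hX : X ⊆ V₁) (hY : Y ⊆ V₂) (hZ : Z ⊆ W) (cX : c ∈ X) (cY : c ∈ Y)
    (qX : q ∈ X) (qZ : q ∈ Z) :
    Glued E₁ (E₂ ∪ D) X (Y ∪ Z) ∧ ∀ z, z ∈ X ∧ z ∈ Y ∪ Z ↔ z = c ∨ z = q := by
  obtain ⟨-, -, -, m4, -⟩ := h.mem_out
  have h12 := h.h12
  exact ⟨h.h1.within.glued (h.h2.within.union h.within_out) (by grind) (by grind), by grind⟩

lemma N_out_mul {Y : Set α} {v : α} (hY : Y ⊆ V₂) (rY : r ∈ Y) (hv : v ∈ Y) (hvr : v ≠ r) :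
    N (E₂ ∪ D) (Y ∪ W) q v = κ * N E₂ Y v r := by
  obtain ⟨⟨m1, m1'⟩, -, m3, -, -⟩ := h.mem_out
  obtain ⟨d1, -⟩ := h.distinct
  rw [N_comm, h.h2.within.N_mul h.within_out m3 hY subset_rfl rY m1' hv hvr m1 (by grind), N_comm D,
    h.N_out, mul_comm]

lemma N_ring : N (E₁ ∪ (E₂ ∪ D)) (V₁ ∪ (V₂ ∪ W)) a b = 2 * f * g * κ := by
  obtain ⟨⟨m1, m1'⟩, m2, m3, m4, m5⟩ := h.mem_out
  obtain ⟨d1, d2, d3, d4⟩ := h.distinct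
  obtain ⟨w, w0, w1, w2⟩ := h.exists_out
  obtain ⟨hG, hJ⟩ := h.glued_aux subset_rfl subset_rfl subset_rfl (by grind) (by grind) (by grind)
    (by grind)
  have h12 := h.h12
  have hac := h.h1.pr
  have hbc := h.h2.pq
  have hqc := h.h1.qr
  have hrc := h.h2.qr
  have hqa := h.h1.pq
  have hrb := h.h2.pr
  have e1 : (V₂ ∪ W) \ {q} = V₂ ∪ W \ {q} := by ext; simp; grind
  have e2 : (V₂ ∪ W) \ {c} = V₂ \ {c} ∪ W := by ext; simp; grind
  have hd : ∀ x y, s(x, y) ∈ E₁ → s(x, y) ∉ E₂ ∪ D := by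
    intro x y hx
    have h0 := h.h1.within x y hx
    have h1 := h.within_out x y
    have h2 := h.h2.within x y
    have := h12 x
    have := h12 y
    have := m4 x
    have := m4 y
    rintro (hy | hy) <;> grind
  rw [N_cross hG hd hJ hqc.symm (by grind) (by grind) (by grind) (by grind) (by grind) (by grind),
    e1, e2,
    h.h2.within.N_zero (X := V₂) (Y := W \ {q}) h.within_out m3 subset_rfl Set.sdiff_subset
      (by grind) (by grind) (by grind) (by grind) (by grind) (by grind) (w := w) ⟨w0, w1⟩ w2,
    h.h2.within.N_zero (X := V₂) (Y := W) h.within_out m3 subset_rfl subset_rfl (by grind)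
      (by grind) (by grind) (by grind) (by grind) (by grind) (w := w) w0 w2,
    h.N_out_mul subset_rfl (by grind) (by grind) hrb,
    h.N_out_mul Set.sdiff_subset (by grind) (by grind) hrb, h.h1.fpq, h.h1.gpq, h.h2.fpr, h.h2.gpr]
  ring

lemma N_ring_middle_aux {Y : Set α} (hY : Y ⊆ V₂) (cY : c ∈ Y) (rY : r ∈ Y) :
    N (E₁ ∪ (E₂ ∪ D)) (V₁ ∪ (Y ∪ W)) a c = g * κ * N E₂ Y c r := by
  obtain ⟨⟨m1, m1'⟩, m2, m3, m4, m5⟩ := h.mem_out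
  obtain ⟨d1, d2, d3, d4⟩ := h.distinct
  obtain ⟨w, w0, w1, w2⟩ := h.exists_out
  obtain ⟨hG, hJ⟩ := h.glued_aux subset_rfl hY subset_rfl (by grind) (by grind) (by grind)
    (by grind)
  rw [N_junction hG hJ h.h1.qr.symm d3.2.1 h.h1.pr h.h1.pq (w := w) (.inr w0) (by grind) w1,
    h.N_out_mul hY rY cY h.h2.qr, h.h1.gpq, mul_assoc]

lemma N_ring_middle : N (E₁ ∪ (E₂ ∪ D)) (V₁ ∪ (V₂ ∪ W)) a c = f * g * κ := by
  rw [h.N_ring_middle_aux subset_rfl h.h2.mq h.h2.mr, h.h2.fqr]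
  ring

lemma N_ring_middle_delete : N (E₁ ∪ (E₂ ∪ D)) ((V₁ ∪ (V₂ ∪ W)) \ {b}) a c = g ^ 2 * κ := by
  obtain ⟨d1, d2, d3, d4⟩ := h.distinct
  have m2 := h.mem_out.2.1
  rw [show (V₁ ∪ (V₂ ∪ W)) \ {b} = V₁ ∪ (V₂ \ {b} ∪ W) by ext; simp; grind,
    h.N_ring_middle_aux Set.sdiff_subset ⟨h.h2.mq, h.h2.pq.symm⟩ ⟨h.h2.mr, h.h2.pr.symm⟩, h.h2.gqr]
  ring

lemma glued_ring : Glued E₀ (E₁ ∪ (E₂ ∪ D)) V₀ (V₁ ∪ (V₂ ∪ W)) ∧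
    ∀ z, z ∈ V₀ ∧ z ∈ V₁ ∪ (V₂ ∪ W) ↔ z = a ∨ z = b := by
  have h01 := h.h01
  have h02 := h.h02
  have m5 := h.mem_out.2.2.2.2
  exact ⟨h.h0.within.glued (h.h1.within.union (h.h2.within.union h.within_out)) (by grind)
    (by grind), by grind⟩

lemma N_left : N (E₀ ∪ (E₁ ∪ (E₂ ∪ D))) (V₀ ∪ (V₁ ∪ (V₂ ∪ W))) p a = 2 * f * g ^ 2 * κ := by
  obtain ⟨d1, d2, d3, d4⟩ := h.distinct
  obtain ⟨hG, hJ⟩ := h.glued_ring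
  rw [N_junction hG hJ h.h0.qr h.h0.mp h.h0.pq h.h0.pr (w := q) (.inl d4.2.1) h.h1.pq.symm
    (by grind), h.h0.gpr, N_comm _ _ b, h.N_ring]
  ring

lemma N_middle : N (E₀ ∪ (E₁ ∪ (E₂ ∪ D))) (V₀ ∪ (V₁ ∪ (V₂ ∪ W))) p c = 4 * f * g ^ 2 * κ := by
  obtain ⟨d1, d2, d3, d4⟩ := h.distinct
  obtain ⟨hG, hJ⟩ := h.glued_ring
  have hd : ∀ x y, s(x, y) ∈ E₀ → s(x, y) ∉ E₁ ∪ (E₂ ∪ D) := by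
    intro x y hx
    have h1 := h.edges_disjoint x y hx
    have h2 := h.h0.within x y hx
    have h3 := h.within_out x y
    have h4 := h.mem_out.2.2.2.2 x
    simp only [Set.mem_union, not_or] at h1 ⊢
    tauto
  have h1 := h.swap_right.N_ring_middle
  have h2 := h.swap_right.N_ring_middle_delete
  rw [← Set.union_assoc, ← Set.union_assoc, Set.union_comm V₂, Set.union_comm E₂, Set.union_assoc,
    Set.union_assoc] at h1 h2
  rw [N_cross hG hd hJ h.h0.qr h.h0.mp h.h0.pq h.h0.pr (.inl d3.2.2.2.2.1) h.h1.pr.symm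
    h.h2.pq.symm, h1, h2, h.N_ring_middle, h.N_ring_middle_delete, h.h0.fpq, h.h0.fpr, h.h0.gpq,
    h.h0.gpr]
  ring

lemma N_interior (hx : x ∈ V₀) (hxa : x ≠ a) (hxb : x ≠ b) :
    f * N (E₀ ∪ (E₁ ∪ (E₂ ∪ D))) (V₀ ∪ (V₁ ∪ (V₂ ∪ W))) p x =
      2 * g * κ * N (E₀ ∪ (E₁ ∪ E₂)) (V₀ ∪ (V₁ ∪ V₂)) p x := by
  obtain ⟨d1, d2, d3, d4⟩ := h.distinct
  obtain ⟨hG, hJ⟩ := h.glued_ring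
  have h01 := h.h01
  have h02 := h.h02
  have h12 := h.h12
  have hq := h.h1.pq.symm
  rw [N_eq_mul_detour hG hJ h.h0.qr h.h0.mp h.h0.pq h.h0.pr hx hxa hxb (w := q) (.inl d4.2.1) hq
      (by grind), h.N_ring,
    N_eq_mul_detour (h.h0.within.glued (h.h1.within.union h.h2.within) (by grind) (by grind))
      (by grind) h.h0.qr h.h0.mp h.h0.pq h.h0.pr hx hxa hxb (w := q) (.inl d4.2.1) hq (by grind),
    h.h1.within.N_mul h.h2.within h12 subset_rfl subset_rfl (by grind) (by grind) (by grind)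
      h.h1.pr (by grind) h.h2.pq, h.h1.fpr, N_comm, h.h2.fpq]
  ring

end Link

end

lemma f_eq_N {n : ℕ} (h : Within (E n) (V n)) (u v : ℝ × ℝ) : f n u v = N (E n) (V n) u v := by
  have adj : ∀ x y, (G n).Adj x y ↔ s(x, y) ∈ E n := fun x y => by
    simpa [G] using fun hxy => (h x y hxy).2.2
  have ham_iff : ∀ {x y : ℝ × ℝ} (p : (G n).Walk x y), p.support ∈ ham (E n) (V n) x y ↔
      IsHamPath n p := fun p => by
    have : p.support.IsChain fun x y => s(x, y) ∈ E n := by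
      simpa only [← adj] using p.isChain_adj_support
    simp only [ham, IsHam, Set.mem_ofPred_eq, IsHamPath, SimpleGraph.Walk.isPath_def, this,
      true_and, List.head?_eq_some_head p.support_ne_nil,
      List.getLast?_eq_some_getLast p.support_ne_nil, SimpleGraph.Walk.head_support,
      SimpleGraph.Walk.getLast_support]
  rw [f, N, ← Nat.card_coe_set_eq]
  refine Nat.card_congr (Equiv.ofBijective (fun p => ⟨p.1.support, (ham_iff _).2 p.2⟩) ⟨?_, ?_⟩)
  · intro p q hpq
    exact Subtype.ext (SimpleGraph.Walk.ext_support (congrArg Subtype.val hpq))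
  · rintro ⟨l, hl⟩
    have hne : l ≠ [] := by
      rintro rfl
      simpa using hl.2.2.1
    have hc : l.IsChain (G n).Adj := by
      simpa only [← adj] using hl.2.1
    have h1 : l.head hne = u := by
      simpa [List.head?_eq_some_head hne] using hl.2.2.1
    have h2 : l.getLast hne = v := by
      simpa [List.getLast?_eq_some_getLast hne] using hl.2.2.2.1
    have hs : ((SimpleGraph.Walk.ofSupport l hne hc).copy h1 h2).support = l := by simp
    exact ⟨⟨_, (ham_iff ((SimpleGraph.Walk.ofSupport l hne hc).copy h1 h2)).1 (by rwa [hs])⟩,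
      Subtype.ext hs⟩

lemma sq3_pos : 0 < sq3 := Real.sqrt_pos.2 (by norm_num)

lemma bounds_of_mem_V {n : ℕ} : ∀ {x : ℝ × ℝ}, x ∈ V n →
    0 ≤ x.2 ∧ x.2 ≤ sq3 * x.1 ∧ sq3 * x.1 + x.2 ≤ sq3 * 2 ^ n := by
  have hs := sq3_pos
  induction n with
  | zero =>
    rintro x (rfl | rfl | rfl) <;> simp only [o, a, b] <;> refine ⟨?_, ?_, ?_⟩ <;> nlinarith
  | succ n ih =>
    have := mul_pos hs (pow_pos (two_pos (α := ℝ)) n)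
    rintro x ((hx | ⟨y, hy, rfl⟩) | ⟨y, hy, rfl⟩)
    · have := ih hx
      rw [pow_succ]
      exact ⟨by linarith, by linarith, by linarith⟩
    all_goals
      have := ih hy
      simp only [a, b, Prod.fst_add, Prod.snd_add, pow_succ]
      exact ⟨by linarith, by linarith, by linarith⟩

lemma Piece.glue3 {n f g : ℕ} (h : Piece f g o (a n) (b n) (V n) (E n)) :
    Glue3 f g o (a (n + 1)) (b (n + 1)) (a n) (b n) (c n) (V n) ((· + a n) '' V n)
      ((· + b n) '' V n) (E n) (Sym2.map (· + a n) '' E n) (Sym2.map (· + b n) '' E n) where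
  h0 := h
  h1 := by
    convert h.equiv (Equiv.addRight (a n)) using 1 <;>
      simp only [Equiv.coe_addRight, o, a, b, c, Prod.mk_add_mk, Prod.mk.injEq] <;> ring_nf <;> simp
  h2 := by
    convert h.equiv (Equiv.addRight (b n)) using 1 <;>
      simp only [Equiv.coe_addRight, o, a, b, c, Prod.mk_add_mk, Prod.mk.injEq] <;> ring_nf <;> simp
  h01 z := by
    have hs := sq3_pos
    refine ⟨?_, ?_⟩
    · rintro ⟨h1, y, h2, rfl⟩
      have h3 := bounds_of_mem_V h1
      have h4 := bounds_of_mem_V h2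
      simp only [a, Prod.fst_add, Prod.snd_add] at h3
      have : sq3 * y.1 = 0 := by linarith
      ext
      · simpa [hs.ne'] using this
      · simp [a]; linarith
    · rintro rfl
      exact ⟨h.mq, o, h.mp, by simp [o]⟩
  h02 z := by
    have hs := sq3_pos
    refine ⟨?_, ?_⟩
    · rintro ⟨h1, y, h2, rfl⟩
      have h3 := bounds_of_mem_V h1
      have h4 := bounds_of_mem_V h2
      simp only [b, Prod.fst_add, Prod.snd_add] at h3
      have : sq3 * y.1 = 0 := by linarith
      ext
      · simpa [hs.ne'] using this
      · simp [b]; linarith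
    · rintro rfl
      exact ⟨h.mr, o, h.mp, by simp [o]⟩
  h12 z := by
    have hs := sq3_pos
    refine ⟨?_, ?_⟩
    · rintro ⟨⟨x, h1, rfl⟩, y, h2, h5⟩
      have h3 := bounds_of_mem_V h1
      have h4 := bounds_of_mem_V h2
      simp only [a, b, Prod.ext_iff, Prod.fst_add, Prod.snd_add] at h5
      have : sq3 * y.1 = sq3 * (x.1 + 2 ^ n / 2) := by rw [← sub_eq_zero]; nlinarith
      have h6 : sq3 * x.1 = sq3 * (2 ^ n / 2) := by nlinarith
      have h7 := mul_left_cancel₀ hs.ne' h6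
      ext
      · simp [a, c]; linarith
      · simp [a, c]; linarith
    · rintro rfl
      refine ⟨⟨b n, h.mr, ?_⟩, a n, h.mq, ?_⟩ <;>
      simp only [a, b, c, Prod.mk_add_mk, Prod.mk.injEq] <;> constructor <;> ring

lemma Glue3.link {α : Type*} {f g f' g' : ℕ} {p q r a b c q' r' c' : α} {V₀ V₁ V₂ W₁ W₂ : Set α}
    {E₀ E₁ E₂ D₁ D₂ : Set (Sym2 α)} (h : Glue3 f g p q r a b c V₀ V₁ V₂ E₀ E₁ E₂)
    (h' : Glue3 f' g' p q' r' q r c' (V₀ ∪ (V₁ ∪ V₂)) W₁ W₂ (E₀ ∪ (E₁ ∪ E₂)) D₁ D₂) :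
    Link f g (f' ^ 2) p q r a b c V₀ V₁ V₂ (W₁ ∪ W₂) E₀ E₁ E₂ (D₁ ∪ D₂) where
  __ := h
  within_out := h'.h1.within.union h'.h2.within
  inter_out z := by
    rw [← h'.h01, ← h'.h02, Set.mem_union _ W₁, and_or_left]
  N_out := by
    obtain ⟨d1, d2, d3, d4⟩ := h'.distinct
    rw [h'.h1.within.N_mul h'.h2.within h'.h12 subset_rfl subset_rfl (by grind) (by grind)
      (by grind) h'.h1.pr (by grind) h'.h2.pq.symm.symm, h'.h1.fpr, N_comm, h'.h2.fpq, sq]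
  exists_out := ⟨q', .inl h'.h1.mq, h'.h1.pq.symm, by
    obtain ⟨d1, d2, d3, d4⟩ := h'.distinct
    grind⟩

/-- The numbers of Hamiltonian paths between two outmost vertices, in `SG n` and
in `SG n` without the third outmost vertex. -/
def hamCount : ℕ → ℕ × ℕ
  | 0 => (1, 1)
  | n + 1 => (2 * (hamCount n).1 ^ 2 * (hamCount n).2,
      2 * (hamCount n).1 * (hamCount n).2 ^ 2 + if n = 0 then (hamCount n).1 ^ 2 else 0)

lemma hamCount_pos (n : ℕ) : 0 < (hamCount n).1 ∧ 0 < (hamCount n).2 := by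
  induction n with
  | zero => simp [hamCount]
  | succ n ih =>
    obtain ⟨h1, h2⟩ := ih
    constructor <;> simp only [hamCount] <;> positivity

lemma o_mem_V (n : ℕ) : o ∈ V n := by
  induction n with
  | zero => exact .inl rfl
  | succ n ih => exact .inl (.inl ih)

theorem piece (n : ℕ) : Piece (hamCount n).1 (hamCount n).2 o (a n) (b n) (V n) (E n) := by
  induction n with
  | zero =>
    refine Piece.triangle ?_ ?_ ?_ <;> simp [o, a, b, Prod.ext_iff]
  | succ n ih =>
    have h := ih.glue3
    rw [V, E, Set.union_assoc, Set.union_assoc]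
    rcases n with - | n
    · have hV : V 0 = {o, a 0, b 0} := rfl
      have ha : (· + a 0) '' V 0 = {a 0, a 1, c 0} := by
        simp only [hV, Set.image_insert_eq, Set.image_singleton]
        congr 2 <;> simp [o, a, b, c] <;> norm_num
      have hb : (· + b 0) '' V 0 = {b 0, c 0, b 1} := by
        simp only [hV, Set.image_insert_eq, Set.image_singleton]
        congr 2 <;> simp [o, a, b, c] <;> norm_num
        ring
      simpa [hamCount] using h.piece_of_eq hV ha hb
    · have hp := pow_pos (two_pos (α := ℝ)) n
      have hs := sq3_pos
      have ha : a n ∈ V (n + 1) := .inl (.inr ⟨o, o_mem_V n, by simp [o]⟩)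
      simpa [hamCount] using h.piece ⟨a n, ha, by simp [a, o], by simp [a], by simp [a, b, hs.ne']⟩
        ⟨_, ⟨a n, ha, rfl⟩, by simp [a], by simp [a, pow_succ]; intro; linarith,
          by simp [a, c, hs.ne']⟩
        ⟨_, ⟨a n, ha, rfl⟩, by simp [a, b], by simp [a, b, c, pow_succ]; intro; linarith,
          by simp [a, b, hs.ne']⟩

lemma V_succ (n : ℕ) : V (n + 1) = V n ∪ ((· + a n) '' V n ∪ (· + b n) '' V n) := by
  rw [V, Set.union_assoc]

lemma E_succ (n : ℕ) :
    E (n + 1) = E n ∪ (Sym2.map (· + a n) '' E n ∪ Sym2.map (· + b n) '' E n) := by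
  rw [E, Set.union_assoc]

lemma F_eq (n : ℕ) (x : ℝ × ℝ) : F n x = N (E n) (V n) o x / (hamCount n).1 := by
  have h := piece n
  rw [F, f1, f_eq_N h.within, f_eq_N h.within, h.fpq]

lemma hamCount_ne_zero (n : ℕ) : ((hamCount n).1 : ℝ) ≠ 0 ∧ ((hamCount n).2 : ℝ) ≠ 0 := by
  exact_mod_cast (hamCount_pos n).imp ne_of_gt ne_of_gt

lemma F_a (n : ℕ) : F n (a n) = 1 := by
  rw [F_eq, (piece n).fpq, div_self (hamCount_ne_zero n).1]

lemma F_b (n : ℕ) : F n (b n) = 1 := by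
  rw [F_eq, (piece n).fpr, div_self (hamCount_ne_zero n).1]

lemma F_succ_a (n : ℕ) : F (n + 1) (a n) = 1 / 2 := by
  obtain ⟨h1, h2⟩ := hamCount_ne_zero n
  rw [F_eq, V_succ, E_succ, (piece n).glue3.N_left, hamCount]
  push_cast
  field_simp

lemma F_succ_b (n : ℕ) : F (n + 1) (b n) = 1 / 2 := by
  obtain ⟨h1, h2⟩ := hamCount_ne_zero n
  rw [F_eq, V_succ, E_succ, Set.union_comm (_ '' V n), Set.union_comm (_ '' E n),
    (piece n).glue3.swap_right.N_left, hamCount]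
  push_cast
  field_simp

lemma F_succ_c (n : ℕ) : F (n + 1) (c n) = 0 := by
  rw [F_eq, V_succ, E_succ, (piece n).glue3.N_middle, Nat.cast_zero, zero_div]

lemma link (n : ℕ) : Link (hamCount n).1 (hamCount n).2 ((hamCount (n + 1)).1 ^ 2)
    o (a (n + 1)) (b (n + 1)) (a n) (b n) (c n) (V n) ((· + a n) '' V n) ((· + b n) '' V n)
    ((· + a (n + 1)) '' V (n + 1) ∪ (· + b (n + 1)) '' V (n + 1))
    (E n) (Sym2.map (· + a n) '' E n) (Sym2.map (· + b n) '' E n)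
    (Sym2.map (· + a (n + 1)) '' E (n + 1) ∪ Sym2.map (· + b (n + 1)) '' E (n + 1)) := by
  refine (piece n).glue3.link ?_ (g' := (hamCount (n + 1)).2) (q' := a (n + 2)) (r' := b (n + 2))
    (c' := c (n + 1))
  rw [← V_succ, ← E_succ]
  exact (piece (n + 1)).glue3

lemma F_add_two (n : ℕ) (x : ℝ × ℝ) : F (n + 2) x =
    N (E n ∪ (Sym2.map (· + a n) '' E n ∪ (Sym2.map (· + b n) '' E n ∪
        (Sym2.map (· + a (n + 1)) '' E (n + 1) ∪ Sym2.map (· + b (n + 1)) '' E (n + 1)))))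
      (V n ∪ ((· + a n) '' V n ∪ ((· + b n) '' V n ∪
        ((· + a (n + 1)) '' V (n + 1) ∪ (· + b (n + 1)) '' V (n + 1))))) o x /
      (2 * ((hamCount (n + 1)).1 : ℝ) ^ 2 * (hamCount (n + 1)).2) := by
  rw [F_eq, V_succ (n + 1), E_succ (n + 1)]
  nth_rw 1 [E_succ n]
  nth_rw 1 [V_succ n]
  simp only [Set.union_assoc, hamCount, Nat.cast_mul, Nat.cast_pow, Nat.cast_ofNat]

variable {n : ℕ}

lemma hamCount_succ_snd (hn : n ≠ 0) :
    (hamCount (n + 1)).2 = 2 * (hamCount n).1 * (hamCount n).2 ^ 2 := by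
  simp [hamCount, hn]

lemma F_add_two_a (hn : n ≠ 0) : F (n + 2) (a n) = 1 / 2 := by
  obtain ⟨h1, h2⟩ := hamCount_ne_zero n
  have h3 := (hamCount_ne_zero (n + 1)).1
  rw [F_add_two, (link n).N_left, hamCount_succ_snd hn]
  push_cast
  field_simp

lemma F_add_two_c (hn : n ≠ 0) : F (n + 2) (c n) = 1 := by
  obtain ⟨h1, h2⟩ := hamCount_ne_zero n
  have h3 := (hamCount_ne_zero (n + 1)).1
  rw [F_add_two, (link n).N_middle, hamCount_succ_snd hn]
  push_cast
  field_simp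
  norm_num

lemma F_add_two_b (hn : n ≠ 0) : F (n + 2) (b n) = 1 / 2 := by
  obtain ⟨h1, h2⟩ := hamCount_ne_zero n
  have h3 := (hamCount_ne_zero (n + 1)).1
  rw [F_add_two, Set.union_left_comm (_ '' V n), Set.union_left_comm (_ '' E n),
    (link n).swap_right.N_left, hamCount_succ_snd hn]
  push_cast
  field_simp

lemma F_add_two_interior (hn : n ≠ 0) {x : ℝ × ℝ} (hx : x ∈ V n) (ha : x ≠ a n) (hb : x ≠ b n) :
    F (n + 2) x = F (n + 1) x := by
  obtain ⟨h1, h2⟩ := hamCount_ne_zero n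
  have h3 := (hamCount_ne_zero (n + 1)).1
  have h4 := congrArg (Nat.cast (R := ℝ)) ((link n).N_interior hx ha hb)
  rw [← V_succ, ← E_succ] at h4
  have h5 : ((hamCount (n + 1)).1 : ℝ) = 2 * (hamCount n).1 ^ 2 * (hamCount n).2 := by
    simp [hamCount]
  push_cast at h4
  rw [F_add_two, F_eq, hamCount_succ_snd hn, div_eq_div_iff (by simp [*]) h3]
  push_cast
  apply mul_left_cancel₀ h1
  rw [← mul_assoc, h4]
  nth_rw 2 [h5]
  ring

lemma V_mono : Monotone V := monotone_nat_of_le_succ fun n => by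
  rw [V_succ]
  exact Set.subset_union_left

lemma F_stable {k : ℕ} (hk : k ≠ 0) {x : ℝ × ℝ} (hx : x ∈ V k) (ha : x ≠ a k) (hb : x ≠ b k)
    (hkn : k + 1 ≤ n) : F n x = F (k + 1) x := by
  induction n, hkn using Nat.le_induction with
  | base => rfl
  | succ n hkn ih =>
    obtain ⟨m, rfl⟩ := Nat.exists_eq_add_of_le' (Nat.le_of_add_left_le hkn)
    rw [← ih]
    have hkm : k ≤ m := by omega
    rcases hkm.eq_or_lt with rfl | hkm'
    · exact F_add_two_interior hk hx ha hb
    have h2 : sq3 * 2 ^ k < sq3 * 2 ^ m :=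
      mul_lt_mul_of_pos_left (pow_lt_pow_right₀ one_lt_two hkm') sq3_pos
    have h3 := (bounds_of_mem_V hx).2.2
    refine F_add_two_interior (by omega) (V_mono hkm hx) ?_ ?_ <;> rintro rfl <;>
      simp only [a, b] at h3 <;> linarith

lemma corners_mem_V (j : ℕ) : (a j ∈ V (j + 1) ∧ b j ∈ V (j + 1) ∧ c j ∈ V (j + 1)) :=
  have h := piece j
  have hc := (h.glue3.h12 (c j)).2 rfl
  ⟨.inl (.inl h.mq), .inl (.inl h.mr), .inl (.inr hc.1)⟩

lemma F_a_stable {j : ℕ} (h : j + 2 ≤ n) : F n (a j) = F (j + 2) (a j) :=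
  F_stable (Nat.succ_ne_zero j) (corners_mem_V j).1 (by simp [a]) (by simp [a, b, sq3_pos.ne']) h

lemma F_b_stable {j : ℕ} (h : j + 2 ≤ n) : F n (b j) = F (j + 2) (b j) :=
  F_stable (Nat.succ_ne_zero j) (corners_mem_V j).2.1 (by simp [a, b, sq3_pos.ne'])
    (by simp [b, sq3_pos.ne']) h

lemma F_c_stable {j : ℕ} (h : j + 2 ≤ n) : F n (c j) = F (j + 2) (c j) :=
  F_stable (Nat.succ_ne_zero j) (corners_mem_V j).2.2 (by simp [a, c, sq3_pos.ne'])
    (by simp [b, c, sq3_pos.ne']) h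

lemma F_a_of_lt {j : ℕ} (hj : j ≠ 0) (h : j < n) : F n (a j) = 1 / 2 := by
  rcases (Nat.succ_le_of_lt h).eq_or_lt with rfl | h
  · exact F_succ_a j
  · rw [F_a_stable h, F_add_two_a hj]

lemma F_b_of_lt {j : ℕ} (hj : j ≠ 0) (h : j < n) : F n (b j) = 1 / 2 := by
  rcases (Nat.succ_le_of_lt h).eq_or_lt with rfl | h
  · exact F_succ_b j
  · rw [F_b_stable h, F_add_two_b hj]

lemma F_c_of_lt {j : ℕ} (hj : j ≠ 0) (h : j + 1 < n) : F n (c j) = 1 := by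
  rw [F_c_stable h, F_add_two_c hj]

lemma sum_C (n : ℕ) (φ : ℝ × ℝ → ℝ) : ∑ x ∈ C n, φ x =
    ∑ j ∈ Finset.range (n + 1), φ (a j) + ∑ j ∈ Finset.range (n + 1), φ (b j) +
      ∑ j ∈ Finset.range n, φ (c j) := by
  have hs := sq3_pos.ne'
  have h2 : ∀ j : ℕ, (2 : ℝ) ^ j ≠ 0 := fun j => by positivity
  have inj : ∀ {i j : ℕ}, (2 : ℝ) ^ i = 2 ^ j → i = j := fun h =>
    pow_right_injective₀ two_pos (by norm_num) h
  rw [C, Finset.sum_union, Finset.sum_union, Finset.sum_image, Finset.sum_image, Finset.sum_image]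
  · intro i _ j _ h
    exact inj (by simpa [c] using congrArg Prod.fst h)
  · intro i _ j _ h
    exact inj (by simpa [b] using congrArg Prod.fst h)
  · intro i _ j _ h
    exact inj (by simpa [a] using congrArg Prod.fst h)
  · simp only [Finset.disjoint_left, Finset.mem_image]
    rintro _ ⟨i, -, rfl⟩ ⟨j, -, h⟩
    simp [a, b, hs] at h
  · simp only [Finset.disjoint_left, Finset.mem_union, Finset.mem_image]
    rintro _ (⟨i, -, rfl⟩ | ⟨i, -, rfl⟩) ⟨j, -, h⟩
    · simp [a, c, hs] at h
    · simp only [b, c, Prod.mk.injEq, mul_eq_mul_right_iff, hs, or_false] at h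
      have := h2 i
      grind

/-- The contribution of the corner vertices at unit distance to a weighted sum of `F`, which does
not depend on the level. -/
def unitTerm (s : ℝ) : ℝ := F 2 (a 0) + F 2 (b 0) + s * F 2 (c 0)

lemma sum_C_weight {w : ℝ × ℝ → ℝ} {r s : ℝ} (ha : ∀ j, w (a j) = r ^ j) (hb : ∀ j, w (b j) = r ^ j)
    (hc : ∀ j, w (c j) = s * r ^ j) (m : ℕ) : ∑ x ∈ C (m + 2), w x * F (m + 2) x =
      unitTerm s + 2 * r ^ (m + 2) + ∑ j ∈ Finset.range (m + 1), r ^ (j + 1) +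
        s * ∑ j ∈ Finset.range m, r ^ (j + 1) := by
  have ea : ∑ j ∈ Finset.range (m + 1), r ^ (j + 1) * F (m + 2) (a (j + 1)) =
      ∑ j ∈ Finset.range (m + 1), r ^ (j + 1) * (1 / 2) := Finset.sum_congr rfl fun j hj => by
    rw [F_a_of_lt j.succ_ne_zero (by simpa using hj)]
  have eb : ∑ j ∈ Finset.range (m + 1), r ^ (j + 1) * F (m + 2) (b (j + 1)) =
      ∑ j ∈ Finset.range (m + 1), r ^ (j + 1) * (1 / 2) := Finset.sum_congr rfl fun j hj => by
    rw [F_b_of_lt j.succ_ne_zero (by simpa using hj)]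
  have ec : ∑ j ∈ Finset.range m, s * r ^ (j + 1) * F (m + 2) (c (j + 1)) =
      ∑ j ∈ Finset.range m, s * r ^ (j + 1) := Finset.sum_congr rfl fun j hj => by
    rw [F_c_of_lt j.succ_ne_zero (by simpa using hj), mul_one]
  have split (u : ℕ → ℝ) (k : ℕ) : ∑ j ∈ Finset.range (k + 2), u j =
      ∑ j ∈ Finset.range k, u (j + 1) + u 0 + u (k + 1) := by
    rw [Finset.sum_range_succ, Finset.sum_range_succ']
  rw [sum_C]
  simp only [ha, hb, hc]
  rw [split _ (m + 1), split _ (m + 1), split _ m, ea, eb, ec, F_a, F_b, F_succ_c,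
    F_a_stable (Nat.le_add_left 2 m),
    F_b_stable (Nat.le_add_left 2 m), F_c_stable (Nat.le_add_left 2 m), unitTerm, ← Finset.sum_mul,
    ← Finset.mul_sum]
  ring

lemma enorm_a (m : ℕ) : enorm (a m) = 2 ^ m := by
  simp [enorm, a]

lemma enorm_b (m : ℕ) : enorm (b m) = 2 ^ m := by
  have h : sq3 ^ 2 = 3 := Real.sq_sqrt (by norm_num)
  rw [enorm, Real.sqrt_eq_iff_eq_sq (by positivity) (by positivity)]
  simp only [b, mul_pow, h]
  ring

lemma enorm_c (m : ℕ) : enorm (c m) = sq3 * 2 ^ m := by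
  have h : sq3 ^ 2 = 3 := Real.sq_sqrt (by norm_num)
  have := sq3_pos
  rw [enorm, Real.sqrt_eq_iff_eq_sq (by positivity) (by positivity)]
  simp only [c, mul_pow, h]
  ring

lemma tendsto_geom_sum_div {r : ℝ} (hr : 1 < r) (K s : ℝ) :
    Tendsto (fun m : ℕ => (K + 2 * r ^ (m + 2) + ∑ j ∈ Finset.range (m + 1), r ^ (j + 1) +
        s * ∑ j ∈ Finset.range m, r ^ (j + 1)) / r ^ (m + 2)) atTop
      (𝓝 (2 + 1 / (r - 1) + s / (r * (r - 1)))) := by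
  have h0 : r ≠ 0 := by linarith
  have h1 : r - 1 ≠ 0 := by linarith
  have hg : ∀ m : ℕ, ∑ j ∈ Finset.range m, r ^ (j + 1) = r * (r ^ m - 1) / (r - 1) := fun m => by
    simp only [pow_succ', ← Finset.mul_sum, geom_sum_eq hr.ne']
    ring
  have key : Tendsto (fun m : ℕ => 2 + 1 / (r - 1) + s / (r * (r - 1)) +
      (K - r / (r - 1) - s * r / (r - 1)) * (r⁻¹) ^ (m + 2)) atTop
      (𝓝 (2 + 1 / (r - 1) + s / (r * (r - 1)) + (K - r / (r - 1) - s * r / (r - 1)) * 0)) :=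
    (((tendsto_pow_atTop_nhds_zero_of_lt_one (by positivity)
      (inv_lt_one_of_one_lt₀ hr)).comp (tendsto_add_atTop_nat 2)).const_mul _).const_add _
  rw [mul_zero, add_zero] at key
  refine key.congr fun m => ?_
  rw [hg, hg, inv_pow]
  field_simp
  ring

lemma tendsto_sum_F : Tendsto (fun n : ℕ => (∑ x ∈ C n, F n x) / n) atTop (𝓝 2) := by
  rw [← tendsto_add_atTop_iff_nat 2]
  have h : Tendsto (fun m : ℕ => 2 + (unitTerm 1 - 1) * ((m + 2 : ℕ) : ℝ)⁻¹) atTop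
      (𝓝 (2 + (unitTerm 1 - 1) * 0)) :=
    ((tendsto_inv_atTop_nhds_zero_nat.comp (tendsto_add_atTop_nat 2)).const_mul _).const_add _
  rw [mul_zero, add_zero] at h
  refine h.congr fun m => ?_
  have h2 := sum_C_weight (w := fun _ => 1) (r := 1) (s := 1) (by simp) (by simp) (by simp) m
  simp only [one_mul] at h2
  rw [h2]
  have : ((m + 2 : ℕ) : ℝ) ≠ 0 := by positivity
  field_simp
  simp
  ring

lemma tendsto_sum_weight {w : ℝ × ℝ → ℝ} {r s : ℝ} (hr : 1 < r) (ha : ∀ j, w (a j) = r ^ j)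
    (hb : ∀ j, w (b j) = r ^ j) (hc : ∀ j, w (c j) = s * r ^ j) :
    Tendsto (fun n : ℕ => (∑ x ∈ C n, w x * F n x) / r ^ n) atTop
      (𝓝 (2 + 1 / (r - 1) + s / (r * (r - 1)))) := by
  rw [← tendsto_add_atTop_iff_nat 2]
  simp only [sum_C_weight ha hb hc]
  exact tendsto_geom_sum_div hr _ s

lemma tendsto_xi' {ℓ r s : ℝ} (hr : 1 < r) (ha : ∀ j, enorm (a j) ^ ℓ = r ^ j)
    (hb : ∀ j, enorm (b j) ^ ℓ = r ^ j) (hc : ∀ j, enorm (c j) ^ ℓ = s * r ^ j) :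
    Tendsto (fun n : ℕ => (n : ℝ) * xi' n ℓ / r ^ n) atTop
      (𝓝 ((2 + 1 / (r - 1) + s / (r * (r - 1))) / 2)) := by
  refine ((tendsto_sum_weight (w := fun x => enorm x ^ ℓ) hr ha hb hc).div
    tendsto_sum_F two_ne_zero).congr fun n => ?_
  rw [xi', Pi.div_apply, div_div_div_eq, mul_div_assoc', div_div, mul_comm (r ^ n),
    mul_comm (n : ℝ)]

/-- mean distance and variance over the corner vertices. -/
theorem mean_distance_and_variance :
    Filter.Tendsto (fun n : ℕ => (n : ℝ) * xi' n 1 / 2 ^ n) Filter.atTop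
      (nhds (3 / 2 + Real.sqrt 3 / 4)) ∧
    Filter.Tendsto (fun n : ℕ => (n : ℝ) * (xi' n 2 - (xi' n 1) ^ 2) / 2 ^ (2 * n))
      Filter.atTop (nhds (31 / 24)) := by
  have h1 : Tendsto (fun n : ℕ => (n : ℝ) * xi' n 1 / 2 ^ n) atTop
      (𝓝 (3 / 2 + Real.sqrt 3 / 4)) := by
    convert tendsto_xi' (ℓ := 1) (s := sq3) one_lt_two (by simp [enorm_a]) (by simp [enorm_b])
      (by simp [enorm_c]) using 2
    rw [sq3]
    ring
  have h2 : Tendsto (fun n : ℕ => (n : ℝ) * xi' n 2 / 4 ^ n) atTop (𝓝 (31 / 24)) := by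
    have h4 : ∀ m : ℕ, ((2 : ℝ) ^ m) ^ 2 = 4 ^ m := fun m => by rw [← pow_mul', pow_mul]; norm_num
    have hs : sq3 ^ 2 = 3 := Real.sq_sqrt (by norm_num)
    convert tendsto_xi' (ℓ := 2) (r := 4) (s := 3) (by norm_num) (by simp [enorm_a, h4])
      (by simp [enorm_b, h4]) (by simp [enorm_c, mul_pow, h4, hs]) using 2
    norm_num
  refine ⟨h1, ?_⟩
  have h3 := h2.sub ((h1.pow 2).mul tendsto_inv_atTop_nhds_zero_nat)
  rw [mul_zero, sub_zero] at h3
  refine h3.congr fun n => ?_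
  rw [pow_mul]
  rcases eq_or_ne (n : ℝ) 0 with hn | hn
  · simp [hn]
  · have h4 : ((2 : ℝ) ^ n) ^ 2 = 4 ^ n := by rw [← pow_mul', pow_mul]; norm_num
    rw [div_pow, h4]
    field_simp
    ring

end SierpinskiGasket
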